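/- arXiv:1910.01326 — 2 statements merged into one kernel-verified Lean document; each statement's English description precedes it below -/
import Mathlib

section
/- Given any positive sequence (β_n), there exist a positive sequence (α_n) with α_n ≤ β_n for all n ≥ 1 and functions ρ₁, ρ₂ ∈ C_c^∞(ℝ) such that for every F ∈ C^∞(ℝ): lim_{p→∞} ⟨ρ₁ ⋆ ∑_{n=0}^{p} (−1)^n α_n δ^{(2n)}, F⟩ = F(0) + ∫_ℝ F(x) ρ₂(x) dx. -/
open MeasureTheory Filter
open scoped BigOperators Topology

/-- Convolution of real functions on the line. -/
noncomputable def conv (w f : ℝ → ℝ) (x : ℝ) : ℝ := ∫ t, w t * f (x - t)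

theorem conv_eq_convolution (w f : ℝ → ℝ) :
    conv w f = convolution w f (ContinuousLinearMap.lsmul ℝ ℝ) volume := rfl

/-- Smooth compactly supported functions on the line. -/
structure IsTest (f : ℝ → ℝ) : Prop where
  smooth : ContDiff ℝ (⊤ : ℕ∞) f
  compact : HasCompactSupport f

section Derivatives

theorem HasCompactSupport.iteratedDeriv_real {f : ℝ → ℝ} (hf : HasCompactSupport f) (n : ℕ) :
    HasCompactSupport (iteratedDeriv n f) := by
  induction n with
  | zero => simpa using hf
  | succ n ih => rw [iteratedDeriv_succ]; exact ih.deriv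

theorem tsupport_iteratedDeriv_subset_real (f : ℝ → ℝ) (n : ℕ) :
    tsupport (iteratedDeriv n f) ⊆ tsupport f := by
  induction n with
  | zero => simp
  | succ n ih => rw [iteratedDeriv_succ]; exact tsupport_deriv_subset.trans ih

theorem ContDiff.iteratedDeriv_real {f : ℝ → ℝ} (n : ℕ) {m : ℕ} (hf : ContDiff ℝ (m + n : ℕ) f) :
    ContDiff ℝ m (iteratedDeriv n f) := by
  induction n generalizing f with
  | zero => simpa using hf
  | succ n ih =>
    rw [iteratedDeriv_succ']
    apply ih
    have : ContDiff ℝ ((m + n : ℕ) + 1) f := by exact_mod_cast hf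
    exact (contDiff_succ_iff_deriv.1 this).2.2

theorem ContDiff.nat_of_top {f : ℝ → ℝ} (hf : ContDiff ℝ (⊤ : ℕ∞) f) (n : ℕ) : ContDiff ℝ n f :=
  hf.of_le (by exact_mod_cast le_top)

theorem contDiff_top_iteratedDeriv {f : ℝ → ℝ} (hf : ContDiff ℝ (⊤ : ℕ∞) f) (n : ℕ) :
    ContDiff ℝ (⊤ : ℕ∞) (iteratedDeriv n f) :=
  contDiff_infty.2 fun m => (hf.nat_of_top (m + n)).iteratedDeriv_real n

theorem IsTest.derivs {f : ℝ → ℝ} (hf : IsTest f) (n : ℕ) : IsTest (iteratedDeriv n f) :=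
  ⟨contDiff_top_iteratedDeriv hf.smooth n, hf.compact.iteratedDeriv_real n⟩

theorem iteratedDeriv_add_index (f : ℝ → ℝ) (m n : ℕ) :
    iteratedDeriv m (iteratedDeriv n f) = iteratedDeriv (m + n) f := by
  induction m with
  | zero => simp
  | succ m ih => rw [iteratedDeriv_succ, ih, show m + 1 + n = (m + n) + 1 by ring, iteratedDeriv_succ]

theorem Continuous.exists_abs_le_of_compact {f : ℝ → ℝ} (hf : Continuous f)
    (hc : HasCompactSupport f) : ∃ C, 0 ≤ C ∧ ∀ x, |f x| ≤ C := by
  obtain ⟨C, hC⟩ := hc.exists_bound_of_continuous hf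
  exact ⟨C, (norm_nonneg _).trans (hC 0), hC⟩

theorem integral_iteratedDeriv_mul {u f : ℝ → ℝ} (hu : IsTest u) (hf : IsTest f) (n : ℕ) :
    ∫ x, iteratedDeriv (2 * n) u x * f x = ∫ x, u x * iteratedDeriv (2 * n) f x := by
  have step : ∀ {u f : ℝ → ℝ}, IsTest u → IsTest f →
      ∫ x, u x * deriv f x = - ∫ x, deriv u x * f x := by
    intro u f hu hf
    have h1 : IsTest (deriv u) := by simpa using hu.derivs 1
    have h2 : IsTest (deriv f) := by simpa using hf.derivs 1
    apply integral_mul_deriv_eq_deriv_mul_of_integrable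
    · exact fun x _ => (hu.smooth.differentiable (by simp) x).hasDerivAt
    · exact fun x _ => (hf.smooth.differentiable (by simp) x).hasDerivAt
    · exact (hu.smooth.continuous.mul h2.smooth.continuous).integrable_of_hasCompactSupport
        hu.compact.mul_right
    · exact (h1.smooth.continuous.mul hf.smooth.continuous).integrable_of_hasCompactSupport
        h1.compact.mul_right
    · exact (hu.smooth.continuous.mul hf.smooth.continuous).integrable_of_hasCompactSupport
        hu.compact.mul_right
  have key : ∀ n, ∫ x, iteratedDeriv n u x * f x = (-1) ^ n * ∫ x, u x * iteratedDeriv n f x := by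
    intro n
    induction n generalizing f with
    | zero => simp
    | succ n ih =>
      have := step (hu.derivs n) hf
      rw [iteratedDeriv_succ, iteratedDeriv_succ', ← neg_eq_iff_eq_neg.2 this,
        ih (by simpa using hf.derivs 1)]
      ring
  rw [key]; simp

end Derivatives

section Convolution

variable {w f g v : ℝ → ℝ}

theorem hasCompactSupport_conv (hw : HasCompactSupport w) (hf : HasCompactSupport f) :
    HasCompactSupport (conv w f) := by
  rw [conv_eq_convolution]; exact hw.convolution _ hf

theorem contDiff_conv {n : ℕ∞} (hw : Continuous w) (hf : ContDiff ℝ n f)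
    (hfc : HasCompactSupport f) : ContDiff ℝ n (conv w f) := by
  rw [conv_eq_convolution]
  exact hfc.contDiff_convolution_right _ hw.locallyIntegrable hf

theorem isTest_conv (hf : IsTest f) (hw : Continuous w) (hwc : HasCompactSupport w) :
    IsTest (conv w f) := ⟨contDiff_conv hw hf.smooth hf.compact, hasCompactSupport_conv hwc hf.compact⟩

theorem deriv_conv (hw : Continuous w) (hf : ContDiff ℝ 1 f) (hfc : HasCompactSupport f) :
    deriv (conv w f) = conv w (deriv f) := by
  ext x
  rw [conv_eq_convolution]
  exact (hfc.hasDerivAt_convolution_right _ hw.locallyIntegrable hf x).deriv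

theorem iteratedDeriv_conv (hw : Continuous w) {n : ℕ} (hf : ContDiff ℝ n f)
    (hfc : HasCompactSupport f) : iteratedDeriv n (conv w f) = conv w (iteratedDeriv n f) := by
  induction n with
  | zero => simp
  | succ n ih =>
    rw [iteratedDeriv_succ, ih (hf.of_le (by exact_mod_cast n.le_succ)), iteratedDeriv_succ,
      deriv_conv hw _ (hfc.iteratedDeriv_real n)]
    exact ContDiff.iteratedDeriv_real n (m := 1) (by simpa [add_comm] using hf)

theorem integrable_conv (hw : Continuous w) (hf : Continuous f) (hwc : HasCompactSupport w)
    (x : ℝ) : Integrable (fun t => w t * f (x - t)) :=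
  (hw.mul (hf.comp (by fun_prop))).integrable_of_hasCompactSupport hwc.mul_right

theorem conv_add (hw : Continuous w) (hwc : HasCompactSupport w) (hf : Continuous f)
    (hg : Continuous g) : conv w (f + g) = conv w f + conv w g := by
  ext x
  simp only [conv, Pi.add_apply, mul_add]
  exact integral_add (integrable_conv hw hf hwc x) (integrable_conv hw hg hwc x)

theorem conv_smul (c : ℝ) : conv w (c • f) = c • conv w f := by
  ext x
  simp only [conv, Pi.smul_apply, smul_eq_mul, ← integral_const_mul]
  congr with t; ring

theorem abs_conv_le (hw : Continuous w) (hwc : HasCompactSupport w) {C : ℝ}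
    (hC : ∀ x, |f x| ≤ C) (x : ℝ) : |conv w f x| ≤ (∫ t, |w t|) * C := by
  rw [← integral_mul_const, ← Real.norm_eq_abs]
  refine norm_integral_le_of_norm_le
    ((hw.abs.integrable_of_hasCompactSupport hwc.abs).mul_const C) (.of_forall fun t => ?_)
  rw [norm_mul]
  exact mul_le_mul_of_nonneg_left (hC _) (norm_nonneg _)

theorem conv_eq_zero {r s : ℝ} (hw : ∀ x, r < |x| → w x = 0) (hf : ∀ x, s < |x| → f x = 0) {x : ℝ}
    (hx : r + s < |x|) : conv w f x = 0 := by
  have : (fun t => w t * f (x - t)) = 0 := by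
    ext t
    by_cases ht : r < |t|
    · simp [hw t ht]
    · have : s < |x - t| := by linarith [abs_sub_abs_le_abs_sub x t]
      simp [hf _ this]
  simp [conv, this]

theorem integral_conv_mul (hw : Continuous w) (hwc : HasCompactSupport w) (heven : ∀ x, w (-x) = w x)
    (hv : Continuous v) (hvc : HasCompactSupport v) (hf : Continuous f) (hfc : HasCompactSupport f) :
    ∫ x, conv w v x * f x = ∫ x, v x * conv w f x := by
  have box : ∀ {a b : ℝ → ℝ} {F : ℝ → ℝ → ℝ}, HasCompactSupport a → HasCompactSupport b →
      (∀ x y, a x = 0 → F x y = 0) → (∀ x y, b y = 0 → F x y = 0) →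
      HasCompactSupport (Function.uncurry F) := by
    intro a b F ha hb h1 h2
    refine HasCompactSupport.intro (ha.isCompact.prod hb.isCompact) fun p hp => ?_
    by_cases h : p.1 ∈ tsupport a
    · exact h2 _ _ (image_eq_zero_of_notMem_tsupport fun h' => hp ⟨h, h'⟩)
    · exact h1 _ _ (image_eq_zero_of_notMem_tsupport h)
  have h1 : ∫ x, conv w v x * f x = ∫ x, ∫ t, w t * v (x - t) * f x := by
    simp only [conv, ← integral_mul_const]
  have h2 : ∫ x, ∫ t, w t * v (x - t) * f x = ∫ t, ∫ x, w t * v (x - t) * f x :=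
    integral_integral_swap_of_hasCompactSupport (by fun_prop)
      (box hfc hwc (by intro x y h; simp [h]) (by intro x y h; simp [h]))
  have h3 : ∀ t, ∫ x, w t * v (x - t) * f x = ∫ y, w t * v y * f (y + t) := fun t => by
    rw [← integral_sub_right_eq_self (fun y => w t * v y * f (y + t)) t]
    simp
  have h4 : ∫ t, ∫ y, w t * v y * f (y + t) = ∫ y, ∫ t, w t * v y * f (y + t) :=
    integral_integral_swap_of_hasCompactSupport (by fun_prop)
      (box hwc hvc (by intro x y h; simp [h]) (by intro x y h; simp [h]))
  have h5 : ∀ y, ∫ t, w t * v y * f (y + t) = v y * conv w f y := fun y => by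
    rw [← integral_neg_eq_self (fun t => w t * v y * f (y + t)), conv, ← integral_const_mul]
    congr with t
    rw [heven, sub_eq_add_neg]; ring
  rw [h1, h2]; simp only [h3]; rw [h4]; simp only [h5]

/-- Convolving with a Lipschitz function gains one derivative. -/
theorem contDiff_conv_of_lipschitz {K : NNReal} (hw : LipschitzWith K w) (hwc : HasCompactSupport w)
    {n : ℕ} (hf : ContDiff ℝ n f) (hfc : HasCompactSupport f) :
    ContDiff ℝ (n + 1 : ℕ) (conv w f) := by
  have hd : Integrable (deriv w) := by
    refine Measure.integrableOn_of_bounded (s := tsupport w) (M := K) hwc.isCompact.measure_ne_top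
      (measurable_deriv w).aestronglyMeasurable (.of_forall fun x => norm_deriv_le_of_lipschitz hw)
      |>.integrable_of_forall_notMem_eq_zero fun x hx => ?_
    exact image_eq_zero_of_notMem_tsupport fun h => hx (tsupport_deriv_subset h)
  have comm : ∀ x, ∫ t, w t * f (x - t) = ∫ y, w (x - y) * f y := fun x => by
    rw [← integral_sub_left_eq_self _ volume x]; simp
  have comm' : ∀ x, ∫ t, deriv w t * f (x - t) = ∫ y, deriv w (x - y) * f y := fun x => by
    rw [← integral_sub_left_eq_self _ volume x]; simp
  have hfi : Integrable f := hf.continuous.integrable_of_hasCompactSupport hfc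
  have key : ∀ x, HasDerivAt (conv w f) (conv (deriv w) f x) x := by
    intro x
    have : conv w f = fun x => ∫ y, w (x - y) * f y := funext comm
    rw [this, conv, comm']
    refine (hasDerivAt_integral_of_dominated_loc_of_lip (s := Set.univ)
      (bound := fun y => K * |f y|) Filter.univ_mem (.of_forall fun x => ?_) ?_ ?_ ?_ ?_ ?_).2
    · exact ((hw.continuous.comp (by fun_prop)).mul hf.continuous).aestronglyMeasurable
    · exact ((hw.continuous.comp (by fun_prop)).mul
        hf.continuous).integrable_of_hasCompactSupport hfc.mul_left
    · exact (((measurable_deriv w).comp (by fun_prop)).mul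
        hf.continuous.measurable).aestronglyMeasurable
    · refine .of_forall fun y => LipschitzWith.lipschitzOnWith (.of_dist_le_mul fun a b => ?_)
      have := hw.dist_le_mul (a - y) (b - y)
      simp only [Real.dist_eq, sub_sub_sub_cancel_right, Real.coe_nnabs, ← sub_mul, abs_mul,
        NNReal.abs_eq, abs_abs] at this ⊢
      nlinarith [abs_nonneg (f y)]
    · exact hfi.abs.const_mul _
    · have hae : ∀ᵐ y, DifferentiableAt ℝ w (x - y) :=
        (quasiMeasurePreserving_sub_left volume x).ae hw.ae_differentiableAt_real
      filter_upwards [hae] with y hy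
      exact (hy.hasDerivAt.comp_sub_const x y).mul_const (f y)
  have hderiv : deriv (conv w f) = conv (deriv w) f := funext fun x => (key x).deriv
  have : ContDiff ℝ ((n : WithTop ℕ∞) + 1) (conv w f) := by
    refine contDiff_succ_iff_deriv.2 ⟨fun x => (key x).differentiableAt, by simp, ?_⟩
    rw [hderiv, conv_eq_convolution]
    exact hfc.contDiff_convolution_right (n := n) _ hd.locallyIntegrable hf
  exact_mod_cast this

end Convolution

section Parametrix

/-- `w` is a compactly supported approximate fundamental solution of `1 - μ D²`, with smooth
error `ψ`: `w - μ w'' = δ + ψ`. -/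
structure IsParametrix (r ε μ : ℝ) (k : ℕ) (w ψ : ℝ → ℝ) : Prop where
  lipschitz : ∃ K, LipschitzWith K w
  nonneg : ∀ x, 0 ≤ w x
  even : ∀ x, w (-x) = w x
  support : ∀ x, r < |x| → w x = 0
  integral_le : ∫ x, w x ≤ 1
  error_smooth : ContDiff ℝ (⊤ : ℕ∞) ψ
  error_even : ∀ x, ψ (-x) = ψ x
  error_support : ∀ x, r < |x| → ψ x = 0
  error_bound : ∀ i ≤ k, ∀ x, |iteratedDeriv i ψ x| ≤ ε
  identity : ∀ F : ℝ → ℝ, ContDiff ℝ (⊤ : ℕ∞) F →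
    (∫ x, w x * F x) - μ * ∫ x, w x * iteratedDeriv 2 F x = F 0 + ∫ x, ψ x * F x

theorem eventually_pow_mul_iteratedDeriv_exp_le {s : ℝ} (hs : 0 < s) (i : ℕ) :
    ∀ b : ℝ → ℝ, IsTest b → tsupport b ⊆ Set.Ici s → ∀ (m : ℕ) (ε : ℝ), 0 < ε →
      ∀ᶠ l : ℝ in atTop, ∀ x,
        |l ^ m * iteratedDeriv i (fun y => b y * Real.exp (-l * y)) x| ≤ ε := by
  induction i with
  | zero =>
    intro b hb hsupp m ε hε
    obtain ⟨C, hC0, hC⟩ := hb.smooth.continuous.exists_abs_le_of_compact hb.compact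
    have hlim : Tendsto (fun l : ℝ => C * (l ^ m * Real.exp (-s * l))) atTop (𝓝 0) := by
      have := (tendsto_rpow_mul_exp_neg_mul_atTop_nhds_zero m s hs).const_mul C
      simpa only [Real.rpow_natCast, mul_zero] using this
    filter_upwards [hlim.eventually_le_const hε, eventually_ge_atTop 0] with l hl hl0 x
    simp only [iteratedDeriv_zero, abs_mul, abs_pow, abs_of_nonneg hl0, Real.abs_exp]
    by_cases hx : x ∈ tsupport b
    · refine le_trans ?_ hl
      have : Real.exp (-l * x) ≤ Real.exp (-s * l) :=
        Real.exp_le_exp.2 (by have := hsupp hx; simp only [Set.mem_Ici] at this; nlinarith)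
      calc l ^ m * (|b x| * Real.exp (-l * x)) ≤ l ^ m * (C * Real.exp (-s * l)) := by
            gcongr; exact hC x
        _ = _ := by ring
    · simp [image_eq_zero_of_notMem_tsupport hx, hε.le]
  | succ i ih =>
    intro b hb hsupp m ε hε
    have hb' : IsTest (deriv b) := by simpa using hb.derivs 1
    filter_upwards [ih _ hb' (tsupport_deriv_subset.trans hsupp) m (ε / 2) (by positivity),
      ih b hb hsupp (m + 1) (ε / 2) (by positivity)] with l h1 h2 x
    have hd : deriv (fun y => b y * Real.exp (-l * y)) =
        (fun y => deriv b y * Real.exp (-l * y)) - fun y => l * (b y * Real.exp (-l * y)) := by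
      ext y
      have e : HasDerivAt (fun y => Real.exp (-l * y)) (Real.exp (-l * y) * -l) y := by
        simpa using ((hasDerivAt_id y).const_mul (-l)).exp
      refine ((hb.smooth.differentiable (by simp) y).hasDerivAt.mul e).deriv.trans ?_
      simp only [Pi.sub_apply]; ring
    have c0 : ContDiff ℝ i (fun y : ℝ => Real.exp (-l * y)) := by fun_prop
    have c1 := (hb'.smooth.nat_of_top i).mul c0
    have c2 := (hb.smooth.nat_of_top i).mul c0
    rw [iteratedDeriv_succ', hd, iteratedDeriv_sub c1.contDiffAt
      (contDiff_const.mul c2).contDiffAt, iteratedDeriv_const_mul _ c2.contDiffAt]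
    calc _ = |l ^ m * iteratedDeriv i (fun y => deriv b y * Real.exp (-l * y)) x
            - l ^ (m + 1) * iteratedDeriv i (fun y => b y * Real.exp (-l * y)) x| := by
          congr 1; ring
      _ ≤ ε / 2 + ε / 2 := (abs_sub _ _).trans (add_le_add (h1 x) (h2 x))
      _ = ε := by ring

theorem eventually_iteratedDeriv_exp_le {s : ℝ} (hs : 0 < s) {b : ℝ → ℝ} (hb : IsTest b)
    (hsupp : tsupport b ⊆ Set.Ici s) (k : ℕ) {ε : ℝ} (hε : 0 < ε) :
    ∀ᶠ l : ℝ in atTop, ∀ i ≤ k, ∀ x,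
      |iteratedDeriv i (fun y => b y * Real.exp (-l * y)) x| ≤ ε := by
  have := (Finset.range (k + 1)).eventually_all.2 fun i _ =>
    eventually_pow_mul_iteratedDeriv_exp_le hs i b hb hsupp 0 ε hε
  filter_upwards [this] with l hl i hi x
  simpa using hl i (by simpa [Nat.lt_succ_iff] using hi) x

theorem integral_even_mul {p F : ℝ → ℝ} (hp : Continuous p) (hpc : HasCompactSupport p)
    (heven : ∀ x, p (-x) = p x) (hF : Continuous F) :
    ∫ x, p x * F x = ∫ x in Set.Ioi 0, p x * (F x + F (-x)) := by
  have i1 : Integrable (fun x => p x * F x) :=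
    (hp.mul hF).integrable_of_hasCompactSupport hpc.mul_right
  have i2 : Integrable (fun x => p x * F (-x)) :=
    (hp.mul (hF.comp continuous_neg)).integrable_of_hasCompactSupport hpc.mul_right
  have h1 : ∫ x, p x * F (-x) = ∫ x, p x * F x := by
    rw [← integral_neg_eq_self]; simp [heven]
  have h2 : ∫ x, p x * (F x + F (-x)) = 2 * ∫ x, p x * F x := by
    simp only [mul_add]; rw [integral_add i1 i2, h1]; ring
  have h3 : (fun x => p x * (F x + F (-x))) = fun x => (fun y => p y * (F y + F (-y))) |x| := by
    ext x
    rcases abs_choice x with h | h <;> simp only [h]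
    rw [heven, neg_neg, add_comm]
  rw [h3, integral_comp_abs (f := fun y => p y * (F y + F (-y)))] at h2
  linarith

theorem integral_Ioi_eq_interval {f : ℝ → ℝ} {r : ℝ} (hr : 0 ≤ r) (hf : ∀ x, r < x → f x = 0) :
    ∫ x in Set.Ioi 0, f x = ∫ x in (0 : ℝ)..r, f x := by
  rw [intervalIntegral.integral_of_le hr]
  refine (setIntegral_eq_of_subset_of_forall_sdiff_eq_zero measurableSet_Ioi
    Set.Ioc_subset_Ioi_self fun x hx => hf x ?_)
  simp only [Set.mem_sdiff, Set.mem_Ioi, Set.mem_Ioc, not_and, not_le] at hx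
  exact hx.2 hx.1

theorem integral_by_parts_twice {A G : ℝ → ℝ} (hA : ContDiff ℝ (⊤ : ℕ∞) A)
    (hG : ContDiff ℝ (⊤ : ℕ∞) G) {r : ℝ} (h1 : A r = 0) (h2 : deriv A r = 0)
    (h3 : deriv G 0 = 0) :
    ∫ x in (0 : ℝ)..r, A x * iteratedDeriv 2 G x =
      deriv A 0 * G 0 + ∫ x in (0 : ℝ)..r, iteratedDeriv 2 A x * G x := by
  have d : ∀ {H : ℝ → ℝ}, ContDiff ℝ (⊤ : ℕ∞) H → (∀ x, HasDerivAt H (deriv H x) x) ∧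
      (∀ x, HasDerivAt (deriv H) (iteratedDeriv 2 H x) x) ∧ Continuous (deriv H) ∧
      Continuous (iteratedDeriv 2 H) := by
    intro H hH
    have hH1 : ContDiff ℝ (⊤ : ℕ∞) (deriv H) := by simpa using contDiff_top_iteratedDeriv hH 1
    refine ⟨fun x => (hH.differentiable (by simp) x).hasDerivAt, fun x => ?_, hH1.continuous,
      (contDiff_top_iteratedDeriv hH 2).continuous⟩
    rw [iteratedDeriv_succ, iteratedDeriv_one]
    exact (hH1.differentiable (by simp) x).hasDerivAt
  obtain ⟨a1, a2, a3, a4⟩ := d hA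
  obtain ⟨g1, g2, g3, g4⟩ := d hG
  rw [intervalIntegral.integral_mul_deriv_eq_deriv_mul (fun x _ => a1 x) (fun x _ => g2 x)
      (a3.intervalIntegrable _ _) (g4.intervalIntegrable _ _),
    intervalIntegral.integral_mul_deriv_eq_deriv_mul (fun x _ => a2 x) (fun x _ => g1 x)
      (a4.intervalIntegrable _ _) (g3.intervalIntegrable _ _), h1, h2, h3]
  ring

theorem exists_smooth_step {r : ℝ} (hr : 0 < r) : ∃ χ : ℝ → ℝ, ContDiff ℝ (⊤ : ℕ∞) χ ∧
    (∀ x, 0 ≤ χ x) ∧ (∀ x, χ x ≤ 1) ∧ (∀ x, x ≤ r / 2 → χ x = 1) ∧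
    (∀ x, 3 * r / 4 ≤ x → χ x = 0) := by
  refine ⟨fun x => Real.smoothTransition (3 - 4 * x / r),
    Real.smoothTransition.contDiff.comp (by fun_prop), fun x => Real.smoothTransition.nonneg _,
    fun x => Real.smoothTransition.le_one _, fun x hx => ?_, fun x hx => ?_⟩
  · refine Real.smoothTransition.one_of_one_le ?_
    have : 4 * x / r ≤ 2 := by rw [div_le_iff₀ hr]; linarith
    linarith
  · refine Real.smoothTransition.zero_of_nonpos ?_
    have : 3 ≤ 4 * x / r := by rw [le_div_iff₀ hr]; linarith
    linarith

theorem isTest_deriv_step {χ : ℝ → ℝ} {a b : ℝ} (hχ : ContDiff ℝ (⊤ : ℕ∞) χ)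
    (h1 : ∀ x, x ≤ a → χ x = 1) (h0 : ∀ x, b ≤ x → χ x = 0) :
    IsTest (deriv χ) ∧ tsupport (deriv χ) ⊆ Set.Icc a b := by
  have hsub : tsupport (deriv χ) ⊆ Set.Icc a b := by
    refine closure_minimal (fun x hx => ?_) isClosed_Icc
    by_contra hx'
    rw [Set.mem_Icc, not_and_or, not_le, not_le] at hx'
    refine hx ?_
    rcases hx' with hx' | hx'
    · have : χ =ᶠ[𝓝 x] fun _ => 1 := by
        filter_upwards [Iio_mem_nhds hx'] with y hy using h1 y (le_of_lt hy)
      rw [this.deriv_eq]; simp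
    · have : χ =ᶠ[𝓝 x] fun _ => 0 := by
        filter_upwards [Ioi_mem_nhds hx'] with y hy using h0 y (le_of_lt hy)
      rw [this.deriv_eq]; simp
  exact ⟨⟨by simpa using contDiff_top_iteratedDeriv hχ 1,
    isCompact_Icc.of_isClosed_subset (isClosed_tsupport _) hsub⟩, hsub⟩

theorem exists_parametrix {r ε : ℝ} (hr : 0 < r) (hε : 0 < ε) (k : ℕ) :
    ∃ m > 0, ∀ μ, 0 < μ → μ < m → ∃ w ψ, IsParametrix r ε μ k w ψ := by
  obtain ⟨χ, hχ, hχ0, hχ1, hone, hzero⟩ := exists_smooth_step hr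
  obtain ⟨t1, s1⟩ := isTest_deriv_step hχ hone hzero
  have t2 : IsTest (deriv (deriv χ)) := by simpa using t1.derivs 1
  have s2 : tsupport (deriv (deriv χ)) ⊆ Set.Icc (r / 2) (3 * r / 4) :=
    tsupport_deriv_subset.trans s1
  have hev := ((eventually_iteratedDeriv_exp_le (half_pos hr) t1 (fun x hx => (s1 hx).1) k
      (ε := ε / 4) (by positivity)).and
    ((eventually_iteratedDeriv_exp_le (half_pos hr) t2 (fun x hx => (s2 hx).1) k
      (ε := ε / 4) (by positivity)).and (eventually_ge_atTop 1)))
  obtain ⟨Λ, hΛ⟩ := eventually_atTop.1 hev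
  have hΛ1 : 0 < max Λ 1 := by positivity
  refine ⟨1 / (max Λ 1) ^ 2, by positivity, fun μ hμ hμm => ?_⟩
  obtain ⟨l, hl0, hlΛ, hlμ⟩ : ∃ l : ℝ, 0 < l ∧ Λ ≤ l ∧ μ = 1 / l ^ 2 := by
    refine ⟨1 / √μ, by positivity, ?_, by simp [Real.sq_sqrt hμ.le]⟩
    rw [le_div_iff₀ (by positivity)]
    have h3 : √μ * max Λ 1 ≤ 1 := by
      rw [lt_div_iff₀ (by positivity)] at hμm
      have : (√μ * max Λ 1) ^ 2 ≤ 1 := by rw [mul_pow, Real.sq_sqrt hμ.le]; exact hμm.le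
      exact (sq_le_one_iff₀ (by positivity)).1 this
    nlinarith [Real.sqrt_nonneg μ, le_max_left Λ 1]
  obtain ⟨b1, b2, hl1⟩ := hΛ l hlΛ
  set A : ℝ → ℝ := fun x => χ x * (l / 2 * Real.exp (-l * x)) with hA
  set B : ℝ → ℝ := (fun x => deriv χ x * Real.exp (-l * x)) -
    fun x => 1 / (2 * l) * (deriv (deriv χ) x * Real.exp (-l * x)) with hB
  have hexp : ∀ c x : ℝ, HasDerivAt (fun y => c * Real.exp (-l * y)) (-l * (c * Real.exp (-l * x))) x := by
    intro c x
    exact ((((hasDerivAt_id' x).const_mul (-l)).exp).const_mul c).congr_deriv (by ring)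
  have hAs : ContDiff ℝ (⊤ : ℕ∞) A := hχ.mul (by fun_prop)
  have cB1 : ContDiff ℝ (⊤ : ℕ∞) (fun x => deriv χ x * Real.exp (-l * x)) :=
    t1.smooth.mul (by fun_prop)
  have cB2 : ContDiff ℝ (⊤ : ℕ∞) (fun x => deriv (deriv χ) x * Real.exp (-l * x)) :=
    t2.smooth.mul (by fun_prop)
  have hBs : ContDiff ℝ (⊤ : ℕ∞) B := cB1.sub (contDiff_const.mul cB2)
  have hBsupp : ∀ x, x ∉ Set.Icc (r / 2) (3 * r / 4) → B x = 0 := fun x hx => by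
    simp [hB, image_eq_zero_of_notMem_tsupport fun h => hx (s1 h),
      image_eq_zero_of_notMem_tsupport fun h => hx (s2 h)]
  have hBb : ∀ i ≤ k, ∀ x, |iteratedDeriv i B x| ≤ ε / 2 := by
    intro i hi x
    rw [hB, iteratedDeriv_sub (cB1.nat_of_top i).contDiffAt
      (contDiff_const.mul (cB2.nat_of_top i)).contDiffAt,
      iteratedDeriv_const_mul _ (cB2.nat_of_top i).contDiffAt]
    have hc : |1 / (2 * l)| ≤ 1 := by
      rw [abs_of_pos (by positivity), div_le_one (by positivity)]; linarith
    refine (abs_sub _ _).trans ?_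
    rw [abs_mul]
    have h1 := b1 i hi x
    have h2 := b2 i hi x
    nlinarith [abs_nonneg (1 / (2 * l)),
      abs_nonneg (iteratedDeriv i (fun x => deriv (deriv χ) x * Real.exp (-l * x)) x)]
  have hA1 : deriv A = fun x => deriv χ x * (l / 2 * Real.exp (-l * x)) - l * A x := by
    ext x
    refine ((hχ.differentiable (by simp) x).hasDerivAt.mul (hexp (l / 2) x)).deriv.trans ?_
    simp only [hA]; ring
  have hA2 : ∀ x, iteratedDeriv 2 A x = deriv (deriv χ) x * (l / 2 * Real.exp (-l * x))
      - 2 * l * (deriv χ x * (l / 2 * Real.exp (-l * x))) + l ^ 2 * A x := by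
    intro x
    rw [iteratedDeriv_succ, iteratedDeriv_one]
    conv_lhs => rw [hA1]
    have := ((t1.smooth.differentiable (by simp) x).hasDerivAt.mul (hexp (l / 2) x)).sub
      ((hAs.differentiable (by simp) x).hasDerivAt.const_mul l)
    rw [HasDerivAt.deriv (f := fun x => deriv χ x * (l / 2 * Real.exp (-l * x)) - l * A x) this,
      congrFun hA1 x]
    ring
  have hAB : ∀ x, A x - μ * iteratedDeriv 2 A x = B x := by
    intro x
    rw [hA2, hlμ]
    simp only [hB, Pi.sub_apply]
    field_simp; ring
  have hwc : Continuous fun x => A |x| := hAs.continuous.comp continuous_abs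
  have hwsupp : ∀ x, r < |x| → A |x| = 0 := fun x hx => by
    simp [hA, hzero |x| (by linarith)]
  have hwcs : HasCompactSupport fun x => A |x| :=
    HasCompactSupport.intro (isCompact_closedBall (0 : ℝ) r) fun x hx => hwsupp x (by
      simpa using hx)
  have hψc : Continuous fun x => B x + B (-x) :=
    hBs.continuous.add (hBs.continuous.comp continuous_neg)
  have hψsupp : ∀ x, r < |x| → B x + B (-x) = 0 := fun x hx => by
    rw [hBsupp x, hBsupp (-x), add_zero] <;>
    · rintro ⟨h1, h2⟩
      rcases abs_cases x with h | h <;> linarith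
  have hψcs : HasCompactSupport fun x => B x + B (-x) :=
    HasCompactSupport.intro (isCompact_closedBall (0 : ℝ) r) fun x hx => hψsupp x (by
      simpa using hx)
  refine ⟨fun x => A |x|, fun x => B x + B (-x), ?_, fun x => ?_, by simp, hwsupp, ?_, ?_,
    fun x => by simp [add_comm], hψsupp, ?_, ?_⟩
  · set T : ℝ → ℝ := fun x => A x * Real.smoothTransition (2 + x) with hT
    have hTs : ContDiff ℝ (⊤ : ℕ∞) T :=
      hAs.mul (Real.smoothTransition.contDiff.comp (by fun_prop))
    have hTc : HasCompactSupport T := by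
      refine HasCompactSupport.intro (isCompact_Icc (a := -2) (b := r)) fun x hx => ?_
      rw [Set.mem_Icc, not_and_or, not_le, not_le] at hx
      rcases hx with hx | hx
      · simp [hT, Real.smoothTransition.zero_of_nonpos (show 2 + x ≤ 0 by linarith)]
      · simp [hT, hA, hzero x (by linarith)]
    obtain ⟨K, hK⟩ := ContDiff.lipschitzWith_of_hasCompactSupport (𝕂 := ℝ) hTc hTs (by simp)
    refine ⟨K * 1, ?_⟩
    have : (fun x => A |x|) = T ∘ fun x => |x| := by
      ext x
      simp [hT, Real.smoothTransition.one_of_one_le (show 1 ≤ 2 + |x| by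
        linarith [abs_nonneg x])]
    rw [this]
    exact hK.comp (lipschitzWith_one_norm (E := ℝ))
  · exact mul_nonneg (hχ0 _) (by positivity)
  · rw [integral_comp_abs]
    have hi : IntegrableOn (fun x => Real.exp (-l * x)) (Set.Ioi 0) :=
      integrableOn_exp_mul_Ioi (by linarith) 0
    have : ∫ x in Set.Ioi 0, A x ≤ ∫ x in Set.Ioi (0 : ℝ), l / 2 * Real.exp (-l * x) := by
      refine integral_mono_of_nonneg (.of_forall fun x => mul_nonneg (hχ0 _) (by positivity))
        (hi.const_mul _) (.of_forall fun x => ?_)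
      exact mul_le_of_le_one_left (by positivity) (hχ1 x)
    rw [integral_const_mul, integral_exp_mul_Ioi (by linarith)] at this
    have h2 : l / 2 * (-Real.exp (-l * 0) / -l) = 1 / 2 := by simp; field_simp
    linarith
  · exact hBs.add (hBs.comp contDiff_neg)
  · intro i hi x
    have : iteratedDeriv i (B + fun x => B (-x)) x = _ :=
      iteratedDeriv_add (hBs.nat_of_top i).contDiffAt
        ((hBs.nat_of_top i).comp contDiff_neg).contDiffAt
    have h2 : |iteratedDeriv i (B + fun x => B (-x)) x| ≤ ε := by
      rw [this, iteratedDeriv_comp_neg]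
      refine (abs_add_le _ _).trans ?_
      rw [smul_eq_mul, abs_mul, abs_pow, abs_neg, abs_one, one_pow, one_mul]
      linarith [hBb i hi x, hBb i hi (-x)]
    exact h2
  · intro F hF
    have hF2 := contDiff_top_iteratedDeriv hF 2
    set G : ℝ → ℝ := F + fun x => F (-x) with hG
    have hGs : ContDiff ℝ (⊤ : ℕ∞) G := hF.add (hF.comp contDiff_neg)
    have hG2 : ∀ x, iteratedDeriv 2 G x = iteratedDeriv 2 F x + iteratedDeriv 2 F (-x) := by
      intro x
      refine (iteratedDeriv_add (hF.nat_of_top 2).contDiffAt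
        ((hF.nat_of_top 2).comp contDiff_neg).contDiffAt).trans ?_
      have := iteratedDeriv_comp_neg 2 F x
      simp_all [Function.comp_def]
    have hG0 : deriv G 0 = 0 := by
      have := iteratedDeriv_add (n := 1) (x := 0) (hF.nat_of_top 1).contDiffAt
        ((hF.nat_of_top 1).comp contDiff_neg).contDiffAt
      simp only [iteratedDeriv_one] at this
      change deriv (F + F ∘ Neg.neg) 0 = 0
      rw [this]
      have := iteratedDeriv_comp_neg 1 F 0
      simp only [iteratedDeriv_one] at this
      simp [Function.comp_def, this]
    have hAr : deriv A r = 0 := by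
      have h0 : A r = 0 := by simp [hA, hzero r (by linarith)]
      have h1 : deriv χ r = 0 :=
        image_eq_zero_of_notMem_tsupport fun h => by linarith [(s1 h).2]
      simp [hA1, h0, h1]
    have hA0 : deriv A 0 = - l ^ 2 / 2 := by
      have h1 : deriv χ 0 = 0 :=
        image_eq_zero_of_notMem_tsupport fun h => by linarith [(s1 h).1]
      have h2 : A 0 = l / 2 := by simp [hA, hone 0 (by linarith)]
      simp only [hA1, h1, h2]
      ring
    have hAcut : ∀ H : ℝ → ℝ, Continuous H → ∫ x, A |x| * H x =
        ∫ x in (0 : ℝ)..r, A x * (H x + H (-x)) := by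
      intro H hH
      rw [integral_even_mul hwc hwcs (by simp) hH, ← integral_Ioi_eq_interval hr.le]
      · exact setIntegral_congr_fun measurableSet_Ioi fun x hx => by
          simp [abs_of_pos (show 0 < x from hx)]
      · intro x hx; simp [hA, hzero x (by linarith)]
    have hBcut : ∫ x, (B x + B (-x)) * F x = ∫ x in (0 : ℝ)..r, B x * G x := by
      rw [integral_even_mul hψc hψcs (by simp [add_comm]) hF.continuous,
        ← integral_Ioi_eq_interval hr.le]
      · exact setIntegral_congr_fun measurableSet_Ioi fun x hx => by
          have : B (-x) = 0 := hBsupp _ fun h => by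
            have := h.1; have : 0 < x := hx; linarith
          simp [this, hG]
      · intro x hx
        rw [hBsupp x fun h => by linarith [h.2], zero_mul]
    have hparts := integral_by_parts_twice hAs hGs (r := r)
      (by simp [hA, hzero r (by linarith)]) hAr hG0
    rw [hAcut F hF.continuous, hAcut _ hF2.continuous, hBcut]
    simp only [hG2] at hparts
    rw [hparts, hA0]
    have hsplit : ∫ x in (0 : ℝ)..r, B x * G x = (∫ x in (0 : ℝ)..r, A x * (F x + F (-x)))
        - μ * ∫ x in (0 : ℝ)..r, iteratedDeriv 2 A x * G x := by
      rw [← intervalIntegral.integral_const_mul, ← intervalIntegral.integral_sub]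
      · refine intervalIntegral.integral_congr fun x _ => ?_
        simp only [← hAB, hG, Pi.add_apply]; ring
      · exact (hAs.continuous.mul hGs.continuous).intervalIntegrable _ _
      · exact (continuous_const.mul ((contDiff_top_iteratedDeriv hAs 2).continuous.mul
          hGs.continuous)).intervalIntegrable _ _
    rw [hsplit]
    have : G 0 = 2 * F 0 := by simp [hG]; ring
    rw [this, hlμ]
    field_simp; ring

end Parametrix

section Sequence

namespace IsParametrix

variable {r ε μ : ℝ} {k : ℕ} {w ψ : ℝ → ℝ}

theorem continuous (h : IsParametrix r ε μ k w ψ) : Continuous w :=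
  let ⟨_, hK⟩ := h.lipschitz
  hK.continuous

theorem hasCompactSupport (h : IsParametrix r ε μ k w ψ) : HasCompactSupport w :=
  HasCompactSupport.intro (isCompact_Icc (a := -r) (b := r)) fun x hx =>
    h.support x (by rwa [Set.mem_Icc, ← abs_le, not_le] at hx)

theorem isTest_error (h : IsParametrix r ε μ k w ψ) : IsTest ψ :=
  ⟨h.error_smooth, HasCompactSupport.intro (isCompact_Icc (a := -r) (b := r)) fun x hx =>
    h.error_support x (by rwa [Set.mem_Icc, ← abs_le, not_le] at hx)⟩

theorem integral_abs_le (h : IsParametrix r ε μ k w ψ) : ∫ x, |w x| ≤ 1 := by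
  simpa only [abs_of_nonneg (h.nonneg _)] using h.integral_le

theorem integral_abs_error_le (h : IsParametrix r ε μ k w ψ) (hr : 0 ≤ r) :
    ∫ x, |ψ x| ≤ 2 * r * ε := by
  have h1 : ∫ x, |ψ x| = ∫ x in Set.Icc (-r) r, |ψ x| := by
    refine (setIntegral_eq_integral_of_forall_compl_eq_zero fun x hx => ?_).symm
    rw [h.error_support x (by rwa [Set.mem_Icc, ← abs_le, not_le] at hx), abs_zero]
  have h2 := norm_setIntegral_le_of_norm_le_const (μ := volume) (s := Set.Icc (-r) r)
    (f := fun x => |ψ x|) (C := ε) (by simp) fun x _ => by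
      simpa using h.error_bound 0 (Nat.zero_le _) x
  rw [h1]
  refine (le_abs_self _).trans (h2.trans_eq ?_)
  rw [Real.volume_real_Icc_of_le (by linarith)]
  ring

theorem abs_one_sub_integral_le (h : IsParametrix r ε μ k w ψ) (hr : 0 ≤ r) :
    |1 - ∫ x, w x| ≤ 2 * r * ε := by
  have h1 := h.identity (fun _ => 1) contDiff_const
  have h2 : iteratedDeriv 2 (fun _ : ℝ => (1 : ℝ)) = fun _ => 0 := by
    funext x
    simp [iteratedDeriv_succ]
  simp only [h2, mul_zero, integral_zero, mul_one, sub_zero] at h1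
  rw [h1, sub_add_cancel_left, abs_neg]
  exact (abs_integral_le_integral_abs).trans (h.integral_abs_error_le hr)

theorem abs_conv_le (h : IsParametrix r ε μ k w ψ) {f : ℝ → ℝ} {C : ℝ} (hC : ∀ x, |f x| ≤ C) (x : ℝ) :
    |conv w f x| ≤ C := by
  refine (_root_.abs_conv_le h.continuous h.hasCompactSupport hC x).trans ?_
  exact mul_le_of_le_one_left ((abs_nonneg _).trans (hC 0)) h.integral_abs_le

theorem conv_sub (h : IsParametrix r ε μ k w ψ) {f : ℝ → ℝ} (hf : IsTest f) :
    conv w f + (-μ) • conv w (iteratedDeriv 2 f) = f + conv ψ f := by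
  funext x
  have h1 := h.identity (fun y => f (x - y)) (hf.smooth.comp (contDiff_const.sub contDiff_id))
  have h2 : iteratedDeriv 2 (fun y => f (x - y)) = fun y => iteratedDeriv 2 f (x - y) := by
    rw [iteratedDeriv_comp_const_sub]
    simp
  rw [h2, sub_zero] at h1
  simp only [Pi.add_apply, Pi.smul_apply, smul_eq_mul, conv]
  linarith

end IsParametrix

/-- A sequence of approximate fundamental solutions with rapidly decreasing parameters, supports
and errors. -/
structure IsParametrixSeq (μ : ℕ → ℝ) (w ψ : ℕ → ℝ → ℝ) : Prop where
  pos : ∀ n, 0 < μ n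
  le : ∀ n, μ n ≤ (1 / 4) ^ (n + 1)
  ratio : ∀ n N, n < N → μ N ≤ (1 / 4) ^ (N + 1) * μ n
  parametrix : ∀ n, IsParametrix ((1 / 2) ^ (n + 1)) ((1 / 4) ^ n) (μ n) n (w n) (ψ n)

theorem exists_isParametrixSeq (β : ℕ → ℝ) (hβ : ∀ n, 0 < β n) :
    ∃ μ w ψ, IsParametrixSeq μ w ψ ∧ ∀ n, 2 * μ n ≤ β (n + 1) := by
  choose m hm hpar using fun n : ℕ => exists_parametrix (r := (1 / 2 : ℝ) ^ (n + 1))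
    (ε := (1 / 4) ^ n) (by positivity) (by positivity) n
  set c : ℕ → ℝ := fun n => min (m n / 2) (min (β (n + 1) / 2) ((1 / 4) ^ (n + 1))) with hc
  have hc0 : ∀ n, 0 < c n := fun n =>
    lt_min (half_pos (hm n)) (lt_min (half_pos (hβ _)) (by positivity))
  have hc4 : ∀ n, c n ≤ (1 / 4) ^ (n + 1) := fun n => (min_le_right _ _).trans (min_le_right _ _)
  have hc1 : ∀ n, c n ≤ 1 := fun n => (hc4 n).trans (pow_le_one₀ (by norm_num) (by norm_num))
  set μ : ℕ → ℝ := fun n => ∏ i ∈ Finset.range (n + 1), c i with hμ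
  have hμ0 : ∀ n, 0 < μ n := fun n => Finset.prod_pos fun i _ => hc0 i
  have hsucc : ∀ n, μ (n + 1) = c (n + 1) * μ n := fun n => by
    simp only [hμ, Finset.prod_range_succ _ (n + 1), mul_comm]
  have hanti : Antitone μ := antitone_nat_of_succ_le fun n => by
    rw [hsucc]; exact mul_le_of_le_one_left (hμ0 n).le (hc1 _)
  have hμ1 : ∀ n, μ n ≤ 1 := fun n =>
    Finset.prod_le_one (fun i _ => (hc0 i).le) fun i _ => hc1 i
  have hμc : ∀ n, μ n ≤ c n := fun n => by
    cases n with
    | zero => simp [hμ]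
    | succ n => rw [hsucc]; exact mul_le_of_le_one_right (hc0 _).le (hμ1 n)
  choose w ψ hw using fun n => hpar n (μ n) (hμ0 n)
    (((hμc n).trans (min_le_left _ _)).trans_lt (half_lt_self (hm n)))
  refine ⟨μ, w, ψ, ⟨hμ0, fun n => (hμc n).trans (hc4 n), fun n N hn => ?_, hw⟩, fun n => ?_⟩
  · obtain ⟨N, rfl⟩ : ∃ M, N = M + 1 := ⟨N - 1, by omega⟩
    rw [hsucc]
    exact mul_le_mul (hc4 _) (hanti (by omega)) (hμ0 _).le (by positivity)
  · have := (hμc n).trans ((min_le_right _ _).trans (min_le_left _ _))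
    linarith

/-- The coefficients of the polynomial `∏_{j < N} (1 + μ_j X)`. -/
noncomputable def prodCoeff (μ : ℕ → ℝ) : ℕ → ℕ → ℝ
  | 0, 0 => 1
  | 0, _ + 1 => 0
  | N + 1, 0 => prodCoeff μ N 0
  | N + 1, n + 1 => prodCoeff μ N (n + 1) + μ N * prodCoeff μ N n

/-- Evaluation at `0` after convolution with `w 0, …, w (N - 1)`. -/
noncomputable def convEval (w : ℕ → ℝ → ℝ) : ℕ → (ℝ → ℝ) → ℝ
  | 0, f => f 0
  | N + 1, f => convEval w N (conv (w N) f)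

/-- The function `R` such that convolving successively with `δ + ψ_j` for `j < N` is convolving
with `δ + R`. -/
noncomputable def errorSum (ψ : ℕ → ℝ → ℝ) : ℕ → ℝ → ℝ
  | 0 => 0
  | N + 1 => errorSum ψ N + (ψ N + conv (ψ N) (errorSum ψ N))

section Coefficients

variable {μ : ℕ → ℝ}

theorem prodCoeff_zero_right (N : ℕ) : prodCoeff μ N 0 = 1 := by
  induction N with
  | zero => rfl
  | succ N ih => exact ih

theorem prodCoeff_eq_zero (N : ℕ) : ∀ n, N < n → prodCoeff μ N n = 0 := by
  induction N with
  | zero =>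
    rintro (_ | n) hn
    · omega
    · rfl
  | succ N ih =>
    rintro (_ | n) hn
    · omega
    · rw [prodCoeff, ih _ (by omega), ih _ (by omega), mul_zero, add_zero]

theorem prodCoeff_self (N : ℕ) : prodCoeff μ N N = ∏ j ∈ Finset.range N, μ j := by
  induction N with
  | zero => rfl
  | succ N ih =>
    rw [prodCoeff, prodCoeff_eq_zero N _ (by omega), ih, zero_add, Finset.prod_range_succ, mul_comm]

theorem prodCoeff_nonneg (hμ : ∀ n, 0 < μ n) (N : ℕ) : ∀ n, 0 ≤ prodCoeff μ N n := by
  induction N with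
  | zero => rintro (_ | n) <;> simp [prodCoeff]
  | succ N ih =>
    rintro (_ | n)
    · exact ih 0
    · exact add_nonneg (ih _) (mul_nonneg (hμ _).le (ih _))

theorem monotone_prodCoeff (hμ : ∀ n, 0 < μ n) (n : ℕ) : Monotone fun N => prodCoeff μ N n :=
  monotone_nat_of_le_succ fun N => by
    cases n with
    | zero => exact le_rfl
    | succ n => exact le_add_of_nonneg_right (mul_nonneg (hμ _).le (prodCoeff_nonneg hμ _ _))

theorem prodCoeff_le_aux (hμ : ∀ n, 0 < μ n) (hr : ∀ n N, n < N → μ N ≤ (1 / 4) ^ (N + 1) * μ n)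
    (N : ℕ) : ∀ n, prodCoeff μ N n ≤ (2 - (1 / 2) ^ N) * ∏ j ∈ Finset.range n, μ j := by
  have hm : ∀ n, 0 < ∏ j ∈ Finset.range n, μ j := fun n => Finset.prod_pos fun i _ => hμ i
  induction N with
  | zero =>
    rintro (_ | n)
    · simp [prodCoeff]; norm_num
    · rw [show prodCoeff μ 0 (n + 1) = 0 from rfl]
      exact mul_nonneg (by norm_num) (hm _).le
  | succ N ih =>
    have hp : (0 : ℝ) < (1 / 2) ^ N := by positivity
    have hp1 : (1 / 2 : ℝ) ^ N ≤ 1 := pow_le_one₀ (by norm_num) (by norm_num)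
    rintro (_ | n)
    · rw [prodCoeff_zero_right, Finset.prod_range_zero, pow_succ]
      linarith
    · rcases lt_trichotomy n N with hn | rfl | hn
      · have h1 : μ N * prodCoeff μ N n ≤ (1 / 2) ^ (N + 1) * ∏ j ∈ Finset.range (n + 1), μ j := by
          calc μ N * prodCoeff μ N n
              ≤ ((1 / 4) ^ (N + 1) * μ n) * (2 * ∏ j ∈ Finset.range n, μ j) := by
                have h2 : prodCoeff μ N n ≤ 2 * ∏ j ∈ Finset.range n, μ j :=
                  (ih n).trans (mul_le_mul_of_nonneg_right (by linarith) (hm n).le)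
                exact mul_le_mul (hr n N hn) h2 (prodCoeff_nonneg hμ _ _)
                  (mul_nonneg (by positivity) (hμ n).le)
            _ = (1 / 2) ^ (N + 1) * (1 / 2) ^ N * ∏ j ∈ Finset.range (n + 1), μ j := by
                rw [Finset.prod_range_succ, show (1 / 4 : ℝ) = 1 / 2 * (1 / 2) by norm_num, mul_pow]
                ring
            _ ≤ _ := by
                have := hm (n + 1)
                gcongr
                exact mul_le_of_le_one_right (by positivity) hp1
        rw [prodCoeff]
        calc _ ≤ (2 - (1 / 2) ^ N) * (∏ j ∈ Finset.range (n + 1), μ j) +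
              (1 / 2) ^ (N + 1) * ∏ j ∈ Finset.range (n + 1), μ j := add_le_add (ih _) h1
          _ = _ := by ring
      · rw [prodCoeff_self]
        refine le_mul_of_one_le_left (hm _).le ?_
        rw [pow_succ]
        linarith
      · rw [prodCoeff_eq_zero _ _ (by omega)]
        refine mul_nonneg ?_ (hm _).le
        rw [pow_succ]
        linarith

theorem prodCoeff_le (hμ : ∀ n, 0 < μ n) (hr : ∀ n N, n < N → μ N ≤ (1 / 4) ^ (N + 1) * μ n)
    (N n : ℕ) : prodCoeff μ N n ≤ 2 * ∏ j ∈ Finset.range n, μ j :=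
  (prodCoeff_le_aux hμ hr N n).trans <| mul_le_mul_of_nonneg_right
    (sub_le_self _ (by positivity)) (Finset.prod_pos fun i _ => hμ i).le

end Coefficients

theorem sum_prodCoeff_succ (μ : ℕ → ℝ) (N : ℕ) (y : ℕ → ℝ) :
    ∑ n ∈ Finset.range (N + 2), (-1) ^ n * prodCoeff μ (N + 1) n * y n =
      ∑ n ∈ Finset.range (N + 1), (-1) ^ n * prodCoeff μ N n * (y n - μ N * y (n + 1)) := by
  rw [Finset.sum_range_succ']
  simp only [prodCoeff, mul_sub, mul_add, add_mul, Finset.sum_add_distrib, Finset.sum_sub_distrib]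
  rw [Finset.sum_range_succ, prodCoeff_eq_zero N (N + 1) (by omega),
    Finset.sum_range_succ' (fun n => (-1) ^ n * prodCoeff μ N n * y n)]
  have : ∀ n : ℕ, (-1) ^ (n + 1) * (μ N * prodCoeff μ N n) * y (n + 1) =
      -((-1) ^ n * prodCoeff μ N n * (μ N * y (n + 1))) := fun n => by ring
  simp only [this, Finset.sum_neg_distrib]
  ring

theorem IsTest.add {f g : ℝ → ℝ} (hf : IsTest f) (hg : IsTest g) : IsTest (f + g) :=
  ⟨hf.smooth.add hg.smooth, hf.compact.add hg.compact⟩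

theorem IsTest.smul {f : ℝ → ℝ} (hf : IsTest f) (c : ℝ) : IsTest (c • f) :=
  ⟨contDiff_const.smul hf.smooth, hf.compact.smul_left (f := fun _ => c)⟩

theorem IsTest.iteratedDeriv_add {f g : ℝ → ℝ} (hf : IsTest f) (hg : IsTest g) (n : ℕ) :
    iteratedDeriv n (f + g) = iteratedDeriv n f + iteratedDeriv n g := by
  funext x
  exact _root_.iteratedDeriv_add (hf.smooth.nat_of_top n).contDiffAt
    (hg.smooth.nat_of_top n).contDiffAt

theorem IsTest.iteratedDeriv_smul {f : ℝ → ℝ} (hf : IsTest f) (c : ℝ) (n : ℕ) :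
    iteratedDeriv n (c • f) = c • iteratedDeriv n f := by
  funext x
  exact iteratedDeriv_const_smul (hf.smooth.nat_of_top n).contDiffAt c

namespace IsParametrixSeq

variable {μ : ℕ → ℝ} {w ψ : ℕ → ℝ → ℝ}

theorem isTest_conv (h : IsParametrixSeq μ w ψ) {f : ℝ → ℝ} (hf : IsTest f) (N : ℕ) :
    IsTest (conv (w N) f) :=
  _root_.isTest_conv hf (h.parametrix N).continuous (h.parametrix N).hasCompactSupport

theorem isTest_conv_error (h : IsParametrixSeq μ w ψ) {f : ℝ → ℝ} (hf : IsTest f) (N : ℕ) :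
    IsTest (conv (ψ N) f) :=
  _root_.isTest_conv hf (h.parametrix N).isTest_error.smooth.continuous
    (h.parametrix N).isTest_error.compact

theorem iteratedDeriv_conv (h : IsParametrixSeq μ w ψ) {f : ℝ → ℝ} (hf : IsTest f) (N n : ℕ) :
    iteratedDeriv n (conv (w N) f) = conv (w N) (iteratedDeriv n f) :=
  _root_.iteratedDeriv_conv (h.parametrix N).continuous (hf.smooth.nat_of_top n) hf.compact

theorem iteratedDeriv_conv_error (h : IsParametrixSeq μ w ψ) {f : ℝ → ℝ} (hf : IsTest f) (N n : ℕ) :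
    iteratedDeriv n (conv (ψ N) f) = conv (ψ N) (iteratedDeriv n f) :=
  _root_.iteratedDeriv_conv (h.parametrix N).isTest_error.smooth.continuous
    (hf.smooth.nat_of_top n) hf.compact

theorem convEval_add_smul (h : IsParametrixSeq μ w ψ) (c : ℝ) (N : ℕ) :
    ∀ f g : ℝ → ℝ, IsTest f → IsTest g →
      convEval w N (f + c • g) = convEval w N f + c * convEval w N g := by
  induction N with
  | zero => intro f g _ _; rfl
  | succ N ih =>
    intro f g hf hg
    have hN := h.parametrix N
    rw [convEval, convEval, convEval, conv_add hN.continuous hN.hasCompactSupport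
      hf.smooth.continuous (hg.smul c).smooth.continuous, conv_smul,
      ih _ _ (h.isTest_conv hf N) (h.isTest_conv hg N)]

theorem convEval_smul (c : ℝ) (N : ℕ) :
    ∀ f : ℝ → ℝ, convEval w N (c • f) = c * convEval w N f := by
  induction N with
  | zero => intro f; rfl
  | succ N ih => intro f; rw [convEval, convEval, conv_smul, ih]

theorem abs_convEval_le (h : IsParametrixSeq μ w ψ) {S : ℝ} (N : ℕ) :
    ∀ f : ℝ → ℝ, (∀ x, |f x| ≤ S) → |convEval w N f| ≤ S := by
  induction N with
  | zero => intro f hS; exact hS 0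
  | succ N ih => intro f hS; exact ih _ fun x => (h.parametrix N).abs_conv_le hS x

theorem abs_conv_error_le (h : IsParametrixSeq μ w ψ) {f : ℝ → ℝ} {S : ℝ} (hS : ∀ x, |f x| ≤ S)
    (N : ℕ) (x : ℝ) : |conv (ψ N) f x| ≤ (1 / 4) ^ N * S := by
  have ht := (h.parametrix N).isTest_error
  refine (abs_conv_le ht.smooth.continuous ht.compact hS x).trans ?_
  refine mul_le_mul_of_nonneg_right ?_ ((abs_nonneg _).trans (hS 0))
  refine ((h.parametrix N).integral_abs_error_le (by positivity)).trans ?_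
  refine mul_le_of_le_one_left (by positivity) ?_
  rw [pow_succ]
  linarith [pow_le_one₀ (n := N) (a := (1 / 2 : ℝ)) (by norm_num) (by norm_num)]

theorem convEval_succ_iteratedDeriv_two (h : IsParametrixSeq μ w ψ) {f : ℝ → ℝ} (hf : IsTest f)
    (N n : ℕ) : convEval w (N + 1) (iteratedDeriv (2 * (n + 1)) f) =
      convEval w N (iteratedDeriv (2 * n) (conv (w N) (iteratedDeriv 2 f))) := by
  rw [convEval, h.iteratedDeriv_conv (hf.derivs 2), iteratedDeriv_add_index, mul_add, mul_one]

theorem abs_convEval_diag_le (h : IsParametrixSeq μ w ψ) (n : ℕ) :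
    ∀ (f : ℝ → ℝ) (S : ℝ), IsTest f → (∀ x, |f x| ≤ S) →
      (∏ j ∈ Finset.range n, μ j) * |convEval w n (iteratedDeriv (2 * n) f)| ≤ 3 ^ n * S := by
  induction n with
  | zero => intro f S _ hS; simpa [convEval] using hS 0
  | succ n ih =>
    intro f S hf hS
    set g := conv (w n) (iteratedDeriv 2 f) with hg
    have hgt : IsTest g := h.isTest_conv (hf.derivs 2) n
    have hbound : ∀ x, |(μ n • g) x| ≤ 3 * S := fun x => by
      have h1 := congrFun ((h.parametrix n).conv_sub hf) x
      simp only [Pi.add_apply, Pi.smul_apply, smul_eq_mul, ← hg] at h1 ⊢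
      have h2 := (h.parametrix n).abs_conv_le hS x
      have h3 := h.abs_conv_error_le hS n x
      have h4 : (1 / 4 : ℝ) ^ n * S ≤ S := mul_le_of_le_one_left ((abs_nonneg _).trans (hS 0))
        (pow_le_one₀ (by norm_num) (by norm_num))
      have h5 := hS x
      rw [abs_le] at h2 h3 h5 ⊢
      constructor <;> linarith [h2.1, h2.2, h3.1, h3.2, h5.1, h5.2]
    have h6 := ih (μ n • g) (3 * S) (hgt.smul _) hbound
    rw [hgt.iteratedDeriv_smul, convEval_smul, abs_mul, abs_of_pos (h.pos n)] at h6
    rw [h.convEval_succ_iteratedDeriv_two hf, Finset.prod_range_succ, pow_succ]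
    linarith

theorem abs_convEval_iteratedDeriv_le (h : IsParametrixSeq μ w ψ) {n N : ℕ} (hn : n < N) :
    ∀ (f : ℝ → ℝ) (S : ℝ), IsTest f → (∀ x, |iteratedDeriv 2 f x| ≤ S) →
      (∏ j ∈ Finset.range (n + 1), μ j) * |convEval w N (iteratedDeriv (2 * (n + 1)) f)| ≤
        μ n * (3 ^ n * S) := by
  induction N, hn using Nat.le_induction with
  | base =>
    intro f S hf hS
    rw [h.convEval_succ_iteratedDeriv_two hf, Finset.prod_range_succ]
    have := h.abs_convEval_diag_le n _ S (h.isTest_conv (hf.derivs 2) n)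
      ((h.parametrix n).abs_conv_le hS)
    nlinarith [h.pos n, mul_le_mul_of_nonneg_left this (h.pos n).le]
  | succ N hN ih =>
    intro f S hf hS
    rw [convEval, ← h.iteratedDeriv_conv hf]
    refine ih _ S (h.isTest_conv hf N) ?_
    rw [h.iteratedDeriv_conv hf]
    exact (h.parametrix N).abs_conv_le hS

theorem abs_prodCoeff_mul_convEval_le (h : IsParametrixSeq μ w ψ) {f : ℝ → ℝ} {S : ℝ}
    (hf : IsTest f) (hS : ∀ x, |f x| ≤ S) (hS2 : ∀ x, |iteratedDeriv 2 f x| ≤ S) (N n : ℕ) :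
    |(-1) ^ n * prodCoeff μ N n * convEval w N (iteratedDeriv (2 * n) f)| ≤ 2 * S * (3 / 4) ^ n := by
  have hS0 : 0 ≤ S := (abs_nonneg _).trans (hS 0)
  rw [abs_mul, abs_mul, abs_pow, abs_neg, abs_one, one_pow, one_mul,
    abs_of_nonneg (prodCoeff_nonneg h.pos N n)]
  rcases lt_or_ge N n with hn | hn
  · rw [prodCoeff_eq_zero N n hn, zero_mul]
    positivity
  cases n with
  | zero =>
    rw [prodCoeff_zero_right, mul_zero, iteratedDeriv_zero, pow_zero]
    linarith [h.abs_convEval_le N f hS]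
  | succ n =>
    calc _ ≤ (2 * ∏ j ∈ Finset.range (n + 1), μ j) *
          |convEval w N (iteratedDeriv (2 * (n + 1)) f)| := by
          gcongr
          exact prodCoeff_le h.pos h.ratio N (n + 1)
      _ ≤ 2 * (μ n * (3 ^ n * S)) := by
          rw [mul_assoc]
          exact mul_le_mul_of_nonneg_left (h.abs_convEval_iteratedDeriv_le hn f S hf hS2) two_pos.le
      _ ≤ 2 * ((1 / 4) ^ (n + 1) * (3 ^ (n + 1) * S)) := by
          gcongr
          · exact h.le n
          · norm_num
          · omega
      _ = 2 * S * (3 / 4) ^ (n + 1) := by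
          rw [show (3 / 4 : ℝ) = 1 / 4 * 3 by norm_num, mul_pow]
          ring

theorem isTest_errorSum (h : IsParametrixSeq μ w ψ) (N : ℕ) : IsTest (errorSum ψ N) := by
  induction N with
  | zero => exact ⟨contDiff_const, HasCompactSupport.zero⟩
  | succ N ih => exact ih.add ((h.parametrix N).isTest_error.add (h.isTest_conv_error ih N))

theorem convEval_sub_smul (h : IsParametrixSeq μ w ψ) {f : ℝ → ℝ} (hf : IsTest f) (N n : ℕ) :
    convEval w (N + 1) (iteratedDeriv (2 * n) f) -
        μ N * convEval w (N + 1) (iteratedDeriv (2 * (n + 1)) f) =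
      convEval w N (iteratedDeriv (2 * n) (f + conv (ψ N) f)) := by
  rw [hf.iteratedDeriv_add (h.isTest_conv_error hf N), h.iteratedDeriv_conv_error hf,
    ← (h.parametrix N).conv_sub (hf.derivs _), h.convEval_add_smul _ _ _ _
      (h.isTest_conv (hf.derivs _) N) (h.isTest_conv ((hf.derivs _).derivs 2) N),
    iteratedDeriv_add_index, convEval, convEval, show 2 + 2 * n = 2 * (n + 1) by ring]
  ring

theorem integral_errorSum_succ_mul (h : IsParametrixSeq μ w ψ) {f : ℝ → ℝ} (hf : IsTest f) (N : ℕ) :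
    f 0 + ∫ x, errorSum ψ (N + 1) x * f x =
      (f + conv (ψ N) f) 0 + ∫ x, errorSum ψ N x * (f + conv (ψ N) f) x := by
  have hN := h.parametrix N
  have hψ := hN.isTest_error
  have hR := h.isTest_errorSum N
  have hint : ∀ {u v : ℝ → ℝ}, IsTest u → IsTest v → Integrable fun x => u x * v x :=
    fun hu hv => (hu.smooth.continuous.mul hv.smooth.continuous).integrable_of_hasCompactSupport
      hu.compact.mul_right
  have h0 : conv (ψ N) f 0 = ∫ x, ψ N x * f x := by
    rw [conv, ← integral_neg_eq_self]
    simp [hN.error_even]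
  simp only [errorSum, Pi.add_apply, add_mul, mul_add]
  rw [integral_add (g := fun x => ψ N x * f x + conv (ψ N) (errorSum ψ N) x * f x)
      (hint hR hf) ((hint hψ hf).add (hint (h.isTest_conv_error hR N) hf)),
    integral_add (hint hψ hf) (hint (h.isTest_conv_error hR N) hf),
    integral_add (hint hR hf) (hint hR (h.isTest_conv_error hf N)), h0,
    integral_conv_mul hψ.smooth.continuous hψ.compact hN.error_even hR.smooth.continuous hR.compact
      hf.smooth.continuous hf.compact]
  ring

theorem sum_prodCoeff_mul_convEval (h : IsParametrixSeq μ w ψ) (N : ℕ) :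
    ∀ f : ℝ → ℝ, IsTest f →
      ∑ n ∈ Finset.range (N + 1), (-1) ^ n * prodCoeff μ N n * convEval w N (iteratedDeriv (2 * n) f) =
        f 0 + ∫ x, errorSum ψ N x * f x := by
  induction N with
  | zero => intro f _; simp [prodCoeff, convEval, errorSum]
  | succ N ih =>
    intro f hf
    rw [h.integral_errorSum_succ_mul hf, ← ih _ (hf.add (h.isTest_conv_error hf N))]
    simp only [← h.convEval_sub_smul hf]
    exact sum_prodCoeff_succ μ N _

end IsParametrixSeq

end Sequence

section Limits

theorem conv_comm (w f : ℝ → ℝ) : conv w f = conv f w := by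
  funext x
  rw [conv, ← integral_sub_left_eq_self _ volume x]
  simp only [conv, sub_sub_cancel, mul_comm]

theorem exists_smooth_tendstoUniformly {v : ℕ → ℝ → ℝ} (hv : ∀ N : ℕ, ContDiff ℝ N (v N))
    {u : ℕ → ℕ → ℝ} (hu : ∀ k, Summable (u k))
    (hb : ∀ k N, k < N → ∀ x, |iteratedDeriv k (v (N + 1) - v N) x| ≤ u k N) :
    ∃ ρ : ℝ → ℝ, ContDiff ℝ (⊤ : ℕ∞) ρ ∧ TendstoUniformly v ρ atTop := by
  have key : ∀ K : ℕ, ∃ ρ : ℝ → ℝ, ContDiff ℝ K ρ ∧ TendstoUniformly v ρ atTop := fun K => by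
    set d : ℕ → ℝ → ℝ := fun j => v (j + (K + 1) + 1) - v (j + (K + 1)) with hd
    have hvK : ∀ N, K ≤ N → ContDiff ℝ K (v N) := fun N hN =>
      (hv N).of_le (by exact_mod_cast hN)
    have hs : ∀ k, Summable fun j => u k (j + (K + 1)) := fun k =>
      (summable_nat_add_iff (K + 1)).2 (hu k)
    refine ⟨fun x => v (K + 1) x + ∑' j, d j x, ?_, ?_⟩
    · refine (hvK _ (by omega)).add (contDiff_tsum (N := K)
        (v := fun k j => u k (j + (K + 1)))
        (fun j => (hvK _ (by omega)).sub (hvK _ (by omega))) (fun k _ => hs k) fun k j x hk => ?_)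
      rw [norm_iteratedFDeriv_eq_norm_iteratedDeriv]
      have hk' : k ≤ K := by exact_mod_cast hk
      exact hb k _ (by omega) x
    · have h1 : TendstoUniformly (fun (n : ℕ) x => ∑ j ∈ Finset.range n, d j x)
          (fun x => ∑' j, d j x) atTop := tendstoUniformly_tsum_nat (hs 0) fun j x => by
        simpa [hd] using hb 0 (j + (K + 1)) (by omega) x
      have h2 : ∀ (n : ℕ) (x : ℝ), v (n + (K + 1)) x =
          v (K + 1) x + ∑ j ∈ Finset.range n, d j x := fun n x => by
        induction n with
        | zero => simp
        | succ n ih =>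
          rw [Finset.sum_range_succ, ← add_assoc (v (K + 1) x), ← ih, add_right_comm n 1 (K + 1)]
          simp only [hd, Pi.sub_apply, add_sub_cancel]
      rw [Metric.tendstoUniformly_iff] at h1 ⊢
      intro ε hε
      rw [← map_add_atTop_eq_nat (K + 1), eventually_map]
      filter_upwards [h1 ε hε] with n hn x
      rw [h2, dist_add_left]
      exact hn x
  obtain ⟨ρ, -, hρ⟩ := key 0
  refine ⟨ρ, contDiff_infty.2 fun K => ?_, hρ⟩
  obtain ⟨ρ', h1, h2⟩ := key K
  rwa [show ρ = ρ' from funext fun x => tendsto_nhds_unique (hρ.tendsto_at x) (h2.tendsto_at x)]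

theorem tendsto_integral_mul_of_tendstoUniformly {v : ℕ → ℝ → ℝ} {ρ f : ℝ → ℝ}
    (hv : ∀ N, Continuous (v N)) (hρ : Continuous ρ) (h : TendstoUniformly v ρ atTop)
    (hf : IsTest f) : Tendsto (fun N => ∫ x, v N x * f x) atTop (𝓝 (∫ x, ρ x * f x)) := by
  have hfc := hf.smooth.continuous
  refine tendsto_integral_filter_of_dominated_convergence (fun x => (|ρ x| + 1) * |f x|)
    (.of_forall fun N => ((hv N).mul hfc).aestronglyMeasurable) ?_ ?_
    (.of_forall fun x => (h.tendsto_at x).mul_const _)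
  · filter_upwards [Metric.tendstoUniformly_iff.1 h 1 one_pos] with N hN
    refine .of_forall fun x => ?_
    rw [norm_mul]
    refine mul_le_mul_of_nonneg_right ?_ (norm_nonneg _)
    have := hN x
    rw [dist_comm, Real.dist_eq] at this
    have h2 := abs_sub_abs_le_abs_sub (v N x) (ρ x)
    rw [Real.norm_eq_abs]
    linarith
  · exact ((hρ.abs.add continuous_const).mul hfc.abs).integrable_of_hasCompactSupport
      hf.compact.abs.mul_left

theorem IsParametrix.abs_conv_sub_le {r ε μ : ℝ} {k : ℕ} {w ψ : ℝ → ℝ}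
    (h : IsParametrix r ε μ k w ψ) (hr : 0 ≤ r) {g : ℝ → ℝ} (hg : ContDiff ℝ 1 g) {A B : ℝ}
    (hA : ∀ x, |deriv g x| ≤ A) (hB : ∀ x, |g x| ≤ B) (x : ℝ) :
    |conv w g x - g x| ≤ r * A + 2 * r * ε * B := by
  have hA0 : 0 ≤ A := (abs_nonneg _).trans (hA 0)
  have hwi : Integrable w := h.continuous.integrable_of_hasCompactSupport h.hasCompactSupport
  have hi := integrable_conv h.continuous hg.continuous h.hasCompactSupport x
  have h1 : conv w g x - g x = (∫ t, w t * (g (x - t) - g x)) - (1 - ∫ t, w t) * g x := by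
    simp only [mul_sub]
    rw [integral_sub hi (hwi.mul_const _), integral_mul_const, conv]
    ring
  have h2 : |∫ t, w t * (g (x - t) - g x)| ≤ r * A := by
    calc |∫ t, w t * (g (x - t) - g x)| ≤ ∫ t, |w t| * (r * A) := by
          rw [← Real.norm_eq_abs]
          refine norm_integral_le_of_norm_le (hwi.abs.mul_const _) (.of_forall fun t => ?_)
          rw [norm_mul, Real.norm_eq_abs, Real.norm_eq_abs]
          by_cases ht : r < |t|
          · simp [h.support t ht]
          · refine mul_le_mul_of_nonneg_left ?_ (abs_nonneg _)
            have := convex_univ.norm_image_sub_le_of_norm_deriv_le (f := g) (C := A)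
              (fun y _ => hg.differentiable one_ne_zero y) (fun y _ => hA y)
              (Set.mem_univ x) (Set.mem_univ (x - t))
            refine this.trans ?_
            rw [sub_sub_cancel_left, norm_neg, Real.norm_eq_abs, mul_comm]
            exact mul_le_mul_of_nonneg_right (not_lt.1 ht) hA0
      _ ≤ r * A := by
          rw [integral_mul_const]
          exact mul_le_of_le_one_left (mul_nonneg hr hA0) h.integral_abs_le
  have h3 : |(1 - ∫ t, w t) * g x| ≤ 2 * r * ε * B := by
    rw [abs_mul]
    exact mul_le_mul (h.abs_one_sub_integral_le hr) (hB x) (abs_nonneg _)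
      ((abs_nonneg _).trans (h.abs_one_sub_integral_le hr))
  rw [h1]
  exact (abs_sub _ _).trans (add_le_add h2 h3)

/-- The iterated convolution of `w 0, …, w N`. -/
noncomputable def kernelIter (w : ℕ → ℝ → ℝ) : ℕ → ℝ → ℝ
  | 0 => w 0
  | N + 1 => conv (w (N + 1)) (kernelIter w N)

namespace IsParametrixSeq

variable {μ : ℕ → ℝ} {w ψ : ℕ → ℝ → ℝ}

theorem hasCompactSupport_kernelIter (h : IsParametrixSeq μ w ψ) (N : ℕ) :
    HasCompactSupport (kernelIter w N) := by
  induction N with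
  | zero => exact (h.parametrix 0).hasCompactSupport
  | succ N ih => exact hasCompactSupport_conv (h.parametrix _).hasCompactSupport ih

theorem contDiff_kernelIter (h : IsParametrixSeq μ w ψ) (N : ℕ) :
    ContDiff ℝ N (kernelIter w N) := by
  induction N with
  | zero => exact contDiff_zero.2 (h.parametrix 0).continuous
  | succ N ih =>
    obtain ⟨K, hK⟩ := (h.parametrix (N + 1)).lipschitz
    exact contDiff_conv_of_lipschitz hK (h.parametrix (N + 1)).hasCompactSupport ih
      (h.hasCompactSupport_kernelIter N)

theorem kernelIter_eq_zero (h : IsParametrixSeq μ w ψ) (N : ℕ) :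
    ∀ x, 1 - (1 / 2) ^ (N + 1) < |x| → kernelIter w N x = 0 := by
  induction N with
  | zero =>
    intro x hx
    refine (h.parametrix 0).support x ?_
    norm_num at hx ⊢
    exact hx
  | succ N ih =>
    intro x hx
    refine conv_eq_zero (h.parametrix (N + 1)).support ih ?_
    rw [pow_succ _ (N + 1)] at hx ⊢
    linarith

theorem convEval_eq_integral (h : IsParametrixSeq μ w ψ) (N : ℕ) :
    ∀ f, IsTest f → convEval w (N + 1) f = ∫ x, kernelIter w N x * f x := by
  induction N with
  | zero =>
    intro f _
    rw [convEval, convEval, conv, ← integral_neg_eq_self]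
    simp [(h.parametrix 0).even, kernelIter]
  | succ N ih =>
    intro f hf
    have hN := h.parametrix (N + 1)
    rw [convEval, ih _ (h.isTest_conv hf _), kernelIter,
      integral_conv_mul hN.continuous hN.hasCompactSupport hN.even (h.contDiff_kernelIter N).continuous
        (h.hasCompactSupport_kernelIter N) hf.smooth.continuous hf.compact]

theorem iteratedDeriv_kernelIter_succ (h : IsParametrixSeq μ w ψ) {k N : ℕ} (hk : k ≤ N) :
    iteratedDeriv k (kernelIter w (N + 1)) = conv (w (N + 1)) (iteratedDeriv k (kernelIter w N)) :=
  _root_.iteratedDeriv_conv (h.parametrix _).continuous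
    ((h.contDiff_kernelIter N).of_le (by exact_mod_cast hk)) (h.hasCompactSupport_kernelIter N)

theorem exists_kernelIter_bound (h : IsParametrixSeq μ w ψ) (k : ℕ) :
    ∃ M, ∀ N, k ≤ N → ∀ x, |iteratedDeriv k (kernelIter w N) x| ≤ M := by
  obtain ⟨M, -, hM⟩ := Continuous.exists_abs_le_of_compact
    ((h.contDiff_kernelIter k).continuous_iteratedDeriv k le_rfl)
    ((h.hasCompactSupport_kernelIter k).iteratedDeriv_real k)
  refine ⟨M, fun N hN => ?_⟩
  induction N, hN using Nat.le_induction with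
  | base => exact hM
  | succ N hN ih =>
    rw [h.iteratedDeriv_kernelIter_succ hN]
    exact (h.parametrix _).abs_conv_le ih

theorem exists_kernel_limit (h : IsParametrixSeq μ w ψ) :
    ∃ ρ : ℝ → ℝ, ContDiff ℝ (⊤ : ℕ∞) ρ ∧ TendstoUniformly (kernelIter w) ρ atTop := by
  choose M hM using h.exists_kernelIter_bound
  refine exists_smooth_tendstoUniformly h.contDiff_kernelIter
    (u := fun k N => (M (k + 1) + M k) * (1 / 2) ^ N)
    (fun k => (summable_geometric_of_lt_one (by norm_num) (by norm_num)).mul_left _)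
    fun k N hk x => ?_
  have hM0 : ∀ k, 0 ≤ M k := fun k => (abs_nonneg _).trans (hM k k le_rfl 0)
  have hcd : ContDiff ℝ (1 + k : ℕ) (kernelIter w N) :=
    (h.contDiff_kernelIter N).of_le (by exact_mod_cast (by omega : 1 + k ≤ N))
  have hcd0 : ContDiff ℝ k (kernelIter w N) := hcd.of_le (by exact_mod_cast (by omega))
  rw [iteratedDeriv_sub ((h.contDiff_kernelIter (N + 1)).of_le
      (by exact_mod_cast (by omega))).contDiffAt hcd0.contDiffAt,
    h.iteratedDeriv_kernelIter_succ hk.le]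
  have h1 := (h.parametrix (N + 1)).abs_conv_sub_le (by positivity)
    (by exact_mod_cast hcd.iteratedDeriv_real k)
    (A := M (k + 1)) (fun y => by rw [← iteratedDeriv_succ]; exact hM _ N hk y) (hM k N hk.le) x
  refine h1.trans ?_
  have hp : (0 : ℝ) < (1 / 2) ^ N := by positivity
  have h4 : (1 / 4 : ℝ) ^ (N + 1) ≤ 1 := pow_le_one₀ (by norm_num) (by norm_num)
  calc _ ≤ (1 / 2) ^ (N + 1 + 1) * M (k + 1) + 2 * (1 / 2) ^ (N + 1 + 1) * 1 * M k := by
        have := hM0 k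
        gcongr
    _ ≤ _ := by
        rw [pow_succ, pow_succ]
        nlinarith [mul_nonneg hp.le (hM0 k), mul_nonneg hp.le (hM0 (k + 1))]

theorem errorSum_eq_zero (h : IsParametrixSeq μ w ψ) (N : ℕ) :
    ∀ x, 1 - (1 / 2) ^ N < |x| → errorSum ψ N x = 0 := by
  induction N with
  | zero => intro x _; rfl
  | succ N ih =>
    intro x hx
    have hp : (0 : ℝ) < (1 / 2) ^ N := by positivity
    have hp1 : (1 / 2 : ℝ) ^ N ≤ 1 := pow_le_one₀ (by norm_num) (by norm_num)
    have h1 := pow_succ (1 / 2 : ℝ) N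
    rw [errorSum, Pi.add_apply, Pi.add_apply, ih x (by linarith),
      (h.parametrix N).error_support x (by linarith),
      conv_eq_zero (h.parametrix N).error_support ih (by linarith)]
    simp

theorem abs_errorSum_le (h : IsParametrixSeq μ w ψ) (N : ℕ) :
    ∀ x, |errorSum ψ N x| ≤ 2 ^ N - 1 := by
  induction N with
  | zero => intro x; simp [errorSum]
  | succ N ih =>
    intro x
    have h1 := h.abs_conv_error_le ih N x
    have h2 : |ψ N x| ≤ (1 / 4) ^ N := by
      simpa using (h.parametrix N).error_bound 0 (Nat.zero_le _) x
    have h3 := ih x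
    have h4 : (1 / 4 : ℝ) ^ N ≤ 1 := pow_le_one₀ (by norm_num) (by norm_num)
    have h5 : (1 / 4 : ℝ) ^ N * 2 ^ N ≤ 1 * 2 ^ N := by gcongr
    rw [errorSum, Pi.add_apply, Pi.add_apply, pow_succ]
    have h6 := abs_add_le (errorSum ψ N x) (ψ N x + conv (ψ N) (errorSum ψ N) x)
    have h7 := abs_add_le (ψ N x) (conv (ψ N) (errorSum ψ N) x)
    linarith

theorem exists_error_limit (h : IsParametrixSeq μ w ψ) :
    ∃ ρ : ℝ → ℝ, ContDiff ℝ (⊤ : ℕ∞) ρ ∧ TendstoUniformly (errorSum ψ) ρ atTop := by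
  refine exists_smooth_tendstoUniformly (fun N => (h.isTest_errorSum N).smooth.nat_of_top N)
    (u := fun _ N => 3 * (1 / 2) ^ N)
    (fun k => (summable_geometric_of_lt_one (by norm_num) (by norm_num)).mul_left _)
    fun k N hk x => ?_
  have hψ := (h.parametrix N).isTest_error
  have hR := h.isTest_errorSum N
  have hbd := (h.parametrix N).error_bound k hk.le
  have hR1 : ∫ t, |errorSum ψ N t| ≤ 2 * 2 ^ N := by
    have h1 : ∫ t, |errorSum ψ N t| = ∫ t in Set.Icc (-1) 1, |errorSum ψ N t| := by
      refine (setIntegral_eq_integral_of_forall_compl_eq_zero fun t ht => ?_).symm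
      rw [Set.mem_Icc, ← abs_le, not_le] at ht
      rw [h.errorSum_eq_zero N t ((sub_le_self _ (by positivity)).trans_lt ht), abs_zero]
    have h2 := norm_setIntegral_le_of_norm_le_const (μ := volume) (s := Set.Icc (-1 : ℝ) 1)
      (f := fun t => |errorSum ψ N t|) (C := 2 ^ N) (by simp) fun t _ => by
        rw [Real.norm_eq_abs, abs_abs]
        linarith [h.abs_errorSum_le N t]
    rw [h1]
    refine (le_abs_self _).trans (h2.trans_eq ?_)
    rw [Real.volume_real_Icc_of_le (by norm_num)]
    ring
  rw [errorSum, add_sub_cancel_left, hψ.iteratedDeriv_add (h.isTest_conv_error hR N), conv_comm,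
    _root_.iteratedDeriv_conv hR.smooth.continuous (hψ.smooth.nat_of_top k) hψ.compact,
    Pi.add_apply]
  have h1 := abs_conv_le hR.smooth.continuous hR.compact hbd x
  have h2 : (1 / 4 : ℝ) ^ N = (1 / 2) ^ N * (1 / 2) ^ N := by
    rw [← mul_pow]; norm_num
  have h3 : (1 / 2 : ℝ) ^ N * 2 ^ N = 1 := by rw [← mul_pow]; norm_num
  have h4 : (1 / 2 : ℝ) ^ N ≤ 1 := pow_le_one₀ (by norm_num) (by norm_num)
  have hp : (0 : ℝ) < (1 / 2) ^ N := by positivity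
  calc _ ≤ (1 / 4) ^ N + 2 * 2 ^ N * (1 / 4) ^ N :=
        (abs_add_le _ _).trans (add_le_add (hbd x) (h1.trans (by gcongr)))
    _ = (1 / 2) ^ N * (1 / 2) ^ N + 2 * ((1 / 2) ^ N * 2 ^ N) * (1 / 2) ^ N := by rw [h2]; ring
    _ ≤ 3 * (1 / 2) ^ N := by rw [h3]; nlinarith

theorem exists_limit_coeff (h : IsParametrixSeq μ w ψ) :
    ∃ a : ℕ → ℝ, (∀ n, 0 < a n) ∧ (∀ n, a n ≤ 2 * ∏ j ∈ Finset.range n, μ j) ∧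
      ∀ n, Tendsto (fun N => prodCoeff μ N n) atTop (𝓝 (a n)) := by
  have hb : ∀ n, BddAbove (Set.range fun N => prodCoeff μ N n) := fun n =>
    ⟨2 * ∏ j ∈ Finset.range n, μ j, Set.forall_mem_range.2 fun N => prodCoeff_le h.pos h.ratio N n⟩
  refine ⟨fun n => ⨆ N, prodCoeff μ N n, fun n => ?_, fun n => ?_, fun n =>
    tendsto_atTop_ciSup (monotone_prodCoeff h.pos n) (hb n)⟩
  · refine lt_of_lt_of_le ?_ (le_ciSup (hb n) n)
    rw [prodCoeff_self]
    exact Finset.prod_pos fun i _ => h.pos i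
  · exact ciSup_le fun N => prodCoeff_le h.pos h.ratio N n

theorem hasSum_limit (h : IsParametrixSeq μ w ψ) {a : ℕ → ℝ}
    (ha : ∀ n, Tendsto (fun N => prodCoeff μ N n) atTop (𝓝 (a n))) {ρ₁ ρ₂ : ℝ → ℝ}
    (hρ₁ : IsTest ρ₁) (hlim₁ : TendstoUniformly (kernelIter w) ρ₁ atTop)
    (hρ₂ : IsTest ρ₂) (hlim₂ : TendstoUniformly (errorSum ψ) ρ₂ atTop) {f : ℝ → ℝ} (hf : IsTest f) :
    HasSum (fun n => (-1) ^ n * a n * ∫ x, ρ₁ x * iteratedDeriv (2 * n) f x)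
      (f 0 + ∫ x, ρ₂ x * f x) := by
  obtain ⟨S₀, -, hS₀⟩ := hf.smooth.continuous.exists_abs_le_of_compact hf.compact
  obtain ⟨S₂, -, hS₂⟩ := (hf.derivs 2).smooth.continuous.exists_abs_le_of_compact
    (hf.derivs 2).compact
  have hbound := h.abs_prodCoeff_mul_convEval_le hf (S := max S₀ S₂)
    (fun x => (hS₀ x).trans (le_max_left _ _)) (fun x => (hS₂ x).trans (le_max_right _ _))
  set S := max S₀ S₂
  have hsum : Summable fun n : ℕ => 2 * S * (3 / 4 : ℝ) ^ n :=
    (summable_geometric_of_lt_one (by norm_num) (by norm_num)).mul_left _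
  have hterm : ∀ n, Tendsto
      (fun N => (-1) ^ n * prodCoeff μ N n * convEval w N (iteratedDeriv (2 * n) f)) atTop
      (𝓝 ((-1) ^ n * a n * ∫ x, ρ₁ x * iteratedDeriv (2 * n) f x)) := fun n => by
    refine ((ha n).const_mul _).mul ((tendsto_add_atTop_iff_nat 1).1 ?_)
    simp only [fun N => h.convEval_eq_integral N _ (hf.derivs (2 * n))]
    exact tendsto_integral_mul_of_tendstoUniformly (fun N => (h.contDiff_kernelIter N).continuous)
      hρ₁.smooth.continuous hlim₁ (hf.derivs _)
  have h1 := tendsto_tsum_of_dominated_convergence hsum hterm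
    (.of_forall fun N n => hbound N n)
  have h2 : ∀ N, ∑' n, (-1) ^ n * prodCoeff μ N n * convEval w N (iteratedDeriv (2 * n) f) =
      f 0 + ∫ x, errorSum ψ N x * f x := fun N => by
    rw [← h.sum_prodCoeff_mul_convEval N f hf]
    refine tsum_eq_sum fun n hn => ?_
    rw [prodCoeff_eq_zero N n (by simpa using hn), mul_zero, zero_mul]
  simp only [h2] at h1
  have h3 := (tendsto_integral_mul_of_tendstoUniformly
    (fun N => (h.isTest_errorSum N).smooth.continuous) hρ₂.smooth.continuous hlim₂ hf).const_add (f 0)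
  rw [tendsto_nhds_unique h3 h1]
  refine (Summable.of_norm_bounded hsum fun n => ?_).hasSum
  exact le_of_tendsto (hterm n).norm (.of_forall fun N => hbound N n)

end IsParametrixSeq

end Limits

theorem tsupport_subset_of_tendstoUniformly {v : ℕ → ℝ → ℝ} {ρ : ℝ → ℝ}
    (hv : ∀ N x, 1 < |x| → v N x = 0) (h : TendstoUniformly v ρ atTop) :
    tsupport ρ ⊆ Set.Icc (-1) 1 := by
  refine closure_minimal (fun x hx => ?_) isClosed_Icc
  by_contra hx'
  rw [Set.mem_Icc, ← abs_le, not_le] at hx'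
  refine hx (tendsto_nhds_unique (h.tendsto_at x) ?_)
  simp only [hv _ x hx', tendsto_const_nhds]

/-- Dixmier–Malliavin Lemma 2.5: given a positive sequence `(β n)`, there are a
positive sequence `(α n)` with `α n ≤ β n` for `n ≥ 1` and
`ρ₁, ρ₂ ∈ C_c^∞(ℝ)` such that for every smooth `F`,
`⟨ρ₁ ⋆ ∑_{n≤p} (-1)ⁿ α n δ^{(2n)}, F⟩ = ∫ (∑_{n≤p} (-1)ⁿ α n ρ₁^{(2n)}) F`
converges to `F(0) + ∫ F ρ₂` as `p → ∞`. -/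
theorem dixmier_malliavin_lemma (β : ℕ → ℝ) (hβ : ∀ n, 0 < β n) :
    ∃ (a : ℕ → ℝ) (ρ₁ ρ₂ : ℝ → ℝ),
      (∀ n, 0 < a n) ∧ (∀ n, 1 ≤ n → a n ≤ β n) ∧
      ContDiff ℝ (⊤ : ℕ∞) ρ₁ ∧ HasCompactSupport ρ₁ ∧
      ContDiff ℝ (⊤ : ℕ∞) ρ₂ ∧ HasCompactSupport ρ₂ ∧
      ∀ F : ℝ → ℝ, ContDiff ℝ (⊤ : ℕ∞) F →
        Tendsto (fun p : ℕ =>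
            ∫ x, (∑ n ∈ Finset.range (p + 1),
              (-1 : ℝ) ^ n * a n * iteratedDeriv (2 * n) ρ₁ x) * F x)
          atTop (𝓝 (F 0 + ∫ x, F x * ρ₂ x)) := by
  obtain ⟨μ, w, ψ, h, hμβ⟩ := exists_isParametrixSeq β hβ
  obtain ⟨a, ha0, hale, ha⟩ := h.exists_limit_coeff
  obtain ⟨ρ₁, hρ₁, hlim₁⟩ := h.exists_kernel_limit
  obtain ⟨ρ₂, hρ₂, hlim₂⟩ := h.exists_error_limit
  have hs₁ : tsupport ρ₁ ⊆ Set.Icc (-1) 1 := tsupport_subset_of_tendstoUniformly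
    (fun N x hx => h.kernelIter_eq_zero N x ((sub_le_self _ (by positivity)).trans_lt hx)) hlim₁
  have hs₂ : tsupport ρ₂ ⊆ Set.Icc (-1) 1 := tsupport_subset_of_tendstoUniformly
    (fun N x hx => h.errorSum_eq_zero N x ((sub_le_self _ (by positivity)).trans_lt hx)) hlim₂
  have ht₁ : IsTest ρ₁ := ⟨hρ₁, isCompact_Icc.of_isClosed_subset (isClosed_tsupport _) hs₁⟩
  have ht₂ : IsTest ρ₂ := ⟨hρ₂, isCompact_Icc.of_isClosed_subset (isClosed_tsupport _) hs₂⟩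
  refine ⟨a, ρ₁, ρ₂, ha0, fun n hn => ?_, hρ₁, ht₁.compact, hρ₂, ht₂.compact, fun F hF => ?_⟩
  · obtain ⟨n, rfl⟩ : ∃ m, n = m + 1 := ⟨n - 1, by omega⟩
    refine (hale _).trans (le_trans ?_ (hμβ n))
    rw [Finset.prod_range_succ]
    have : ∏ j ∈ Finset.range n, μ j ≤ 1 := Finset.prod_le_one (fun i _ => (h.pos i).le)
      fun i _ => (h.le i).trans (pow_le_one₀ (by norm_num) (by norm_num))
    nlinarith [h.pos n]
  · let b : ContDiffBump (0 : ℝ) := ⟨1, 2, one_pos, one_lt_two⟩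
    have hb : ∀ x ∈ Set.Icc (-1 : ℝ) 1, b x = 1 := fun x hx =>
      b.one_of_mem_closedBall (by rwa [Real.closedBall_eq_Icc, zero_sub, zero_add])
    set f : ℝ → ℝ := fun x => F x * b x with hf
    have hft : IsTest f := ⟨hF.mul b.contDiff, b.hasCompactSupport.mul_left⟩
    have hcongr : ∀ u : ℝ → ℝ, tsupport u ⊆ Set.Icc (-1) 1 → ∀ x, u x * F x = u x * f x :=
      fun u hu x => by
        by_cases hx : x ∈ Set.Icc (-1 : ℝ) 1
        · simp only [hf, hb x hx, mul_one]
        · rw [image_eq_zero_of_notMem_tsupport fun h => hx (hu h), zero_mul, zero_mul]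
    have hterm : ∀ p : ℕ, ∫ x, (∑ n ∈ Finset.range (p + 1),
        (-1 : ℝ) ^ n * a n * iteratedDeriv (2 * n) ρ₁ x) * F x =
        ∑ n ∈ Finset.range (p + 1), (-1) ^ n * a n * ∫ x, ρ₁ x * iteratedDeriv (2 * n) f x :=
      fun p => by
        simp only [Finset.sum_mul, mul_assoc, fun n x => hcongr _
          ((tsupport_iteratedDeriv_subset_real ρ₁ (2 * n)).trans hs₁) x]
        have hint : ∀ n, Integrable fun x => iteratedDeriv (2 * n) ρ₁ x * f x := fun n =>
          ((ht₁.derivs (2 * n)).smooth.continuous.mul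
            hft.smooth.continuous).integrable_of_hasCompactSupport hft.compact.mul_left
        rw [integral_finsetSum _ fun n _ => ((hint n).const_mul _).const_mul _]
        simp only [integral_const_mul, integral_iteratedDeriv_mul ht₁ hft]
    simp only [hterm]
    have h0 : F 0 = f 0 := by simp only [hf, hb 0 (by norm_num), mul_one]
    simp only [mul_comm (F _), hcongr ρ₂ hs₂, h0]
    exact ((h.hasSum_limit ha ht₁ hlim₁ ht₂ hlim₂ hft).tendsto_sum_nat).comp (tendsto_add_atTop_nat 1)
end

section
/- Reverse Bernstein inequality for Fourier series: for every q ∈ [1,∞] there is a constant C such that for any N ∈ ℕ* and any finitely supported complex sequence (α_k)_{|k| ≥ N}: ‖∑_{|k|≥N} α_k e^{ik·}‖_{L^q(−π,π)} ≤ (C/N)·‖∑_{|k|≥N} k α_k e^{ik·}‖_{L^q(−π,π)}. -/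
open MeasureTheory
open scoped BigOperators ENNReal

theorem integral_exp_int (n : ℤ) :
    ∫ t in (-Real.pi)..Real.pi, Complex.exp (Complex.I * n * t) =
      if n = 0 then 2 * (Real.pi : ℂ) else 0 := by
  split_ifs with h
  · simp [h]; ring
  · have hc : Complex.I * (n : ℂ) ≠ 0 := by simp [h]
    rw [integral_exp_mul_complex hc]
    have : Complex.exp (Complex.I * n * (Real.pi : ℝ)) =
        Complex.exp (Complex.I * n * ((-Real.pi : ℝ) : ℂ)) :=
      Complex.exp_eq_exp_iff_exists_int.2 ⟨n, by push_cast; ring⟩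
    rw [this, sub_self, zero_div]

/-- The Dirichlet-type sum `∑_{j<m} e^{ijt}`. -/
noncomputable def expSum (m : ℕ) (t : ℝ) : ℂ :=
  ∑ j ∈ Finset.range m, Complex.exp (Complex.I * (j : ℤ) * t)

theorem continuous_expSum (m : ℕ) : Continuous (expSum m) := by
  unfold expSum; fun_prop

theorem normSq_expSum (m : ℕ) (t : ℝ) :
    ((‖expSum m t‖ ^ 2 : ℝ) : ℂ) = ∑ a ∈ Finset.range m, ∑ b ∈ Finset.range m,
      Complex.exp (Complex.I * ((a - b : ℤ) : ℂ) * t) := by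
  rw [Complex.ofReal_pow, ← Complex.mul_conj', expSum, map_sum, Finset.sum_mul_sum]
  refine Finset.sum_congr rfl fun a _ => Finset.sum_congr rfl fun b _ => ?_
  rw [← Complex.exp_conj, ← Complex.exp_add]
  congr 1
  simp
  ring

theorem integral_normSq_expSum (m : ℕ) :
    ∫ t in (-Real.pi)..Real.pi, ‖expSum m t‖ ^ 2 = 2 * Real.pi * m := by
  apply Complex.ofReal_injective
  rw [← intervalIntegral.integral_ofReal]
  simp_rw [normSq_expSum]
  rw [intervalIntegral.integral_finsetSum
    fun a _ => Continuous.intervalIntegrable (by fun_prop) _ _]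
  have (a : ℕ) (ha : a ∈ Finset.range m) : ∫ t in (-Real.pi)..Real.pi, ∑ b ∈ Finset.range m,
      Complex.exp (Complex.I * ((a - b : ℤ) : ℂ) * t) = 2 * (Real.pi : ℂ) := by
    rw [intervalIntegral.integral_finsetSum
      fun a _ => Continuous.intervalIntegrable (by fun_prop) _ _]
    simp_rw [integral_exp_int, sub_eq_zero, Nat.cast_inj]
    rw [Finset.sum_ite_eq, if_pos ha]
  rw [Finset.sum_congr rfl this]
  simp
  ring

theorem integral_expSum_pow_four_mul_exp (m : ℕ) (k : ℤ) (hk : 2 * (m : ℤ) - 1 ≤ |k|) :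
    ∫ t in (-Real.pi)..Real.pi, ((‖expSum m t‖ ^ 4 : ℝ) : ℂ) * Complex.exp (Complex.I * k * t)
      = 0 := by
  have expand (t : ℝ) : ((‖expSum m t‖ ^ 4 : ℝ) : ℂ) * Complex.exp (Complex.I * k * t) =
      ∑ a ∈ Finset.range m, ∑ c ∈ Finset.range m, ∑ b ∈ Finset.range m, ∑ d ∈ Finset.range m,
        Complex.exp (Complex.I * ((a - b + (c - d) + k : ℤ) : ℂ) * t) := by
    rw [show ‖expSum m t‖ ^ 4 = ‖expSum m t‖ ^ 2 * ‖expSum m t‖ ^ 2 by ring, Complex.ofReal_mul,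
      normSq_expSum, Finset.sum_mul_sum]
    simp_rw [Finset.sum_mul_sum, Finset.sum_mul, ← Complex.exp_add]
    refine Finset.sum_congr rfl fun a _ => Finset.sum_congr rfl fun c _ =>
      Finset.sum_congr rfl fun b _ => Finset.sum_congr rfl fun d _ => ?_
    congr 1
    push_cast
    ring
  simp_rw [expand]
  rw [intervalIntegral.integral_finsetSum
    fun a _ => Continuous.intervalIntegrable (by fun_prop) _ _]
  refine Finset.sum_eq_zero fun a ha => ?_
  rw [intervalIntegral.integral_finsetSum
    fun a _ => Continuous.intervalIntegrable (by fun_prop) _ _]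
  refine Finset.sum_eq_zero fun c hc => ?_
  rw [intervalIntegral.integral_finsetSum
    fun a _ => Continuous.intervalIntegrable (by fun_prop) _ _]
  refine Finset.sum_eq_zero fun b hb => ?_
  rw [intervalIntegral.integral_finsetSum
    fun a _ => Continuous.intervalIntegrable (by fun_prop) _ _]
  refine Finset.sum_eq_zero fun d hd => ?_
  rw [integral_exp_int, if_neg]
  simp only [Finset.mem_range] at ha hb hc hd
  intro h
  rcases abs_cases k with h1 | h1 <;> omega

theorem abs_mul_norm_expSum_le (m : ℕ) {t : ℝ} (ht : |t| ≤ Real.pi) :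
    |t| * ‖expSum m t‖ ≤ Real.pi := by
  have h1 : ‖1 - Complex.exp (Complex.I * t)‖ * ‖expSum m t‖ ≤ 2 := by
    have : (1 - Complex.exp (Complex.I * t)) * expSum m t
        = 1 - Complex.exp (Complex.I * (m * t : ℝ)) := by
      have : expSum m t = ∑ j ∈ Finset.range m, Complex.exp (Complex.I * t) ^ j := by
        refine Finset.sum_congr rfl fun j _ => ?_
        rw [← Complex.exp_nat_mul]
        congr 1
        push_cast
        ring
      rw [this, mul_neg_geom_sum, ← Complex.exp_nat_mul]
      congr 2
      push_cast
      ring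
    rw [← norm_mul, this]
    refine (norm_sub_le _ _).trans ?_
    rw [Complex.norm_exp_I_mul_ofReal]
    norm_num
  have h2 : 2 / Real.pi * |t| ≤ ‖1 - Complex.exp (Complex.I * t)‖ := by
    rw [norm_sub_rev, Complex.norm_exp_I_mul_ofReal_sub_one, norm_mul, Real.norm_eq_abs,
      Real.norm_eq_abs, abs_of_pos (two_pos (α := ℝ))]
    have := Real.mul_abs_le_abs_sin (x := t / 2) (by rw [abs_div, abs_two]; linarith)
    rw [abs_div, abs_two] at this
    linarith
  have h3 := (mul_le_mul_of_nonneg_right h2 (norm_nonneg (expSum m t))).trans h1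
  have hp := Real.pi_pos
  rw [div_mul_eq_mul_div, div_mul_eq_mul_div, div_le_iff₀ hp] at h3
  linarith

theorem half_le_norm_expSum {m : ℕ} {t : ℝ} (ht : |m * t| ≤ 1) : (m / 2 : ℝ) ≤ ‖expSum m t‖ := by
  refine le_trans ?_ (Complex.re_le_norm _)
  rw [expSum, Complex.re_sum]
  have (j : ℕ) (hj : j ∈ Finset.range m) :
      (1 / 2 : ℝ) ≤ (Complex.exp (Complex.I * (j : ℤ) * t)).re := by
    rw [show Complex.I * (j : ℤ) * t = ((j * t : ℝ) : ℂ) * Complex.I by push_cast; ring,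
      Complex.exp_ofReal_mul_I_re]
    have h1 : |j * t| ≤ 1 := by
      refine le_trans ?_ ht
      rw [abs_mul, abs_mul, Nat.abs_cast, Nat.abs_cast]
      have := Finset.mem_range.1 hj
      gcongr
    have := Real.one_sub_sq_div_two_le_cos (x := j * t)
    have := (sq_le_one_iff_abs_le_one _).2 h1
    linarith
  refine le_trans (le_of_eq ?_) (Finset.sum_le_sum this)
  simp
  ring

theorem le_integral_expSum_pow_four {m : ℕ} (hm : 0 < m) :
    (m : ℝ) ^ 3 / 8 ≤ ∫ t in (-Real.pi)..Real.pi, ‖expSum m t‖ ^ 4 := by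
  have hm1 : (1 : ℝ) ≤ m := by exact_mod_cast hm
  have hpi : (m : ℝ)⁻¹ ≤ Real.pi := (inv_le_one_of_one_le₀ hm1).trans
    (by linarith [Real.pi_gt_three])
  have hinv : 0 < (m : ℝ)⁻¹ := by positivity
  have hc := continuous_expSum m
  have hint (a b : ℝ) : IntervalIntegrable (fun t => ‖expSum m t‖ ^ 4) volume a b :=
    Continuous.intervalIntegrable (by fun_prop) _ _
  calc (m : ℝ) ^ 3 / 8 = ∫ t in (-(m : ℝ)⁻¹)..(m : ℝ)⁻¹, (m / 2 : ℝ) ^ 4 := by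
        rw [intervalIntegral.integral_const, smul_eq_mul]
        field_simp
        norm_num
    _ ≤ ∫ t in (-(m : ℝ)⁻¹)..(m : ℝ)⁻¹, ‖expSum m t‖ ^ 4 := by
        refine intervalIntegral.integral_mono_on (by linarith) (by simp) (hint _ _) fun t ht => ?_
        gcongr
        refine half_le_norm_expSum ?_
        rw [abs_mul, Nat.abs_cast, ← le_div_iff₀' (by positivity), one_div]
        exact abs_le.2 ht
    _ ≤ _ := intervalIntegral.integral_mono_interval (by linarith) (by linarith) hpi
        (Filter.Eventually.of_forall fun t => by positivity) (hint _ _)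

theorem integral_abs_mul_expSum_pow_four_le {m : ℕ} (hm : 0 < m) :
    ∫ t in (-Real.pi)..Real.pi, |t| * ‖expSum m t‖ ^ 4 ≤
      (1 / 2 + 8 * Real.pi ^ 3) / m * ∫ t in (-Real.pi)..Real.pi, ‖expSum m t‖ ^ 4 := by
  have hm0 : (0 : ℝ) < m := by exact_mod_cast hm
  have hp := Real.pi_pos
  have hc := continuous_expSum m
  have hle := le_integral_expSum_pow_four hm
  calc ∫ t in (-Real.pi)..Real.pi, |t| * ‖expSum m t‖ ^ 4
      ≤ ∫ t in (-Real.pi)..Real.pi,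
          (1 / (2 * m) * ‖expSum m t‖ ^ 4 + m / 2 * Real.pi ^ 2 * ‖expSum m t‖ ^ 2) := by
        refine intervalIntegral.integral_mono_on (by linarith)
          (Continuous.intervalIntegrable (by fun_prop) _ _)
          (Continuous.intervalIntegrable (by fun_prop) _ _) fun t ht => ?_
        have h1 : |t| ≤ 1 / (2 * m) + m / 2 * |t| ^ 2 := by
          have : 1 / (2 * m) + m / 2 * |t| ^ 2 - |t| = (m * |t| - 1) ^ 2 / (2 * m) := by
            field_simp
            ring
          have : 0 ≤ (m * |t| - 1) ^ 2 / (2 * m) := by positivity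
          linarith
        have h2 : (|t| * ‖expSum m t‖) ^ 2 ≤ Real.pi ^ 2 := by
          gcongr
          exact abs_mul_norm_expSum_le m (abs_le.2 ht)
        calc |t| * ‖expSum m t‖ ^ 4
            ≤ (1 / (2 * m) + m / 2 * |t| ^ 2) * ‖expSum m t‖ ^ 4 := by gcongr
          _ = 1 / (2 * m) * ‖expSum m t‖ ^ 4 +
                m / 2 * (|t| * ‖expSum m t‖) ^ 2 * ‖expSum m t‖ ^ 2 := by ring
          _ ≤ _ := by gcongr
    _ = 1 / (2 * m) * (∫ t in (-Real.pi)..Real.pi, ‖expSum m t‖ ^ 4) +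
          8 * Real.pi ^ 3 / m * ((m : ℝ) ^ 3 / 8) := by
        rw [intervalIntegral.integral_add (Continuous.intervalIntegrable (by fun_prop) _ _)
          (Continuous.intervalIntegrable (by fun_prop) _ _), intervalIntegral.integral_const_mul,
          intervalIntegral.integral_const_mul, integral_normSq_expSum]
        field_simp
    _ ≤ 1 / (2 * m) * (∫ t in (-Real.pi)..Real.pi, ‖expSum m t‖ ^ 4) +
          8 * Real.pi ^ 3 / m * (∫ t in (-Real.pi)..Real.pi, ‖expSum m t‖ ^ 4) := by gcongr
    _ = _ := by
        field_simp

/-- Reverse Bernstein inequality in a normed space of functions on the circle, whose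
norm is invariant under translations. -/
theorem norm_sum_le_of_translation_invariant {E : Type*} [NormedAddCommGroup E]
    [NormedSpace ℂ E] [CompleteSpace E] (e : ℤ → E) (s : Finset ℤ)
    (hinv : ∀ (a : ℤ → ℂ) (t : ℝ),
      ‖∑ k ∈ s, (a k * Complex.exp (Complex.I * k * t)) • e k‖ = ‖∑ k ∈ s, a k • e k‖)
    {N : ℕ} (hN : 0 < N) (hs : ∀ k ∈ s, (N : ℤ) ≤ |k|) (α : ℤ → ℂ) :
    ‖∑ k ∈ s, α k • e k‖ ≤
      (1 + 16 * Real.pi ^ 3) / N * ‖∑ k ∈ s, ((k : ℂ) * α k) • e k‖ := by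
  set u : ℝ → E := fun t => ∑ k ∈ s, (α k * Complex.exp (Complex.I * k * t)) • e k with hu
  set A := ‖∑ k ∈ s, ((k : ℂ) * α k) • e k‖ with hA
  have hu0 : u 0 = ∑ k ∈ s, α k • e k := by simp [hu]
  have hlip (t : ℝ) : ‖u 0 - u t‖ ≤ A * |t| := by
    have hder (x : ℝ) : HasDerivAt u
        (Complex.I • ∑ k ∈ s, ((k * α k) * Complex.exp (Complex.I * k * x)) • e k) x := by
      rw [Finset.smul_sum]
      refine HasDerivAt.fun_sum fun k _ => ?_
      have h1 : HasDerivAt (fun y : ℝ => Complex.I * k * (y : ℂ)) (Complex.I * k) x := by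
        simpa using (Complex.ofRealCLM.hasDerivAt (x := x)).const_mul (Complex.I * k)
      have h2 := (h1.cexp.const_mul (α k)).smul_const (e k)
      convert h2 using 1
      rw [smul_smul]
      congr 1
      ring
    have := Convex.norm_image_sub_le_of_norm_hasDerivWithin_le (f := u) (C := A) (s := Set.univ)
      (x := t) (y := 0) (fun x _ => (hder x).hasDerivWithinAt)
      (fun x _ => by rw [norm_smul, Complex.norm_I, one_mul, hinv]) convex_univ
      (Set.mem_univ _) (Set.mem_univ _)
    simpa using this
  set m := (N + 1) / 2 with hm
  have hm0 : 0 < m := by omega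
  have hmN : (N : ℝ) ≤ 2 * m := by
    have : N ≤ 2 * m := by omega
    exact_mod_cast this
  have hN0 : (0 : ℝ) < N := by exact_mod_cast hN
  have hc := continuous_expSum m
  have hucont : Continuous u := by fun_prop
  have hp := Real.pi_pos
  set J := ∫ t in (-Real.pi)..Real.pi, ‖expSum m t‖ ^ 4 with hJ
  have hJpos : 0 < J := lt_of_lt_of_le (by positivity) (le_integral_expSum_pow_four hm0)
  have hzero : ∫ t in (-Real.pi)..Real.pi, ((‖expSum m t‖ ^ 4 : ℝ) : ℂ) • u t = 0 := by
    simp_rw [hu, Finset.smul_sum, smul_smul]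
    rw [intervalIntegral.integral_finsetSum
      fun a _ => Continuous.intervalIntegrable (by fun_prop) _ _]
    refine Finset.sum_eq_zero fun k hk => ?_
    have h := integral_expSum_pow_four_mul_exp m k (by have := hs k hk; omega)
    rw [intervalIntegral.integral_smul_const]
    simp_rw [mul_left_comm _ (α k)]
    rw [intervalIntegral.integral_const_mul, h, mul_zero, zero_smul]
  have hrep : (J : ℂ) • u 0 =
      ∫ t in (-Real.pi)..Real.pi, ((‖expSum m t‖ ^ 4 : ℝ) : ℂ) • (u 0 - u t) := by
    simp_rw [smul_sub]
    rw [intervalIntegral.integral_sub (Continuous.intervalIntegrable (by fun_prop) _ _)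
      (Continuous.intervalIntegrable (by fun_prop) _ _), hzero, sub_zero,
      intervalIntegral.integral_smul_const, intervalIntegral.integral_ofReal]
  have hbound : J * ‖u 0‖ ≤ A * ((1 / 2 + 8 * Real.pi ^ 3) / m * J) := by
    calc J * ‖u 0‖ = ‖(J : ℂ) • u 0‖ := by
          rw [norm_smul, Complex.norm_real, Real.norm_of_nonneg hJpos.le]
      _ ≤ ∫ t in (-Real.pi)..Real.pi, A * (|t| * ‖expSum m t‖ ^ 4) := by
          rw [hrep]
          refine intervalIntegral.norm_integral_le_of_norm_le (by linarith)
            (Filter.Eventually.of_forall fun t _ => ?_)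
            (Continuous.intervalIntegrable (by fun_prop) _ _)
          rw [norm_smul, Complex.norm_real, Real.norm_of_nonneg (by positivity)]
          calc ‖expSum m t‖ ^ 4 * ‖u 0 - u t‖ ≤ ‖expSum m t‖ ^ 4 * (A * |t|) := by
                gcongr
                exact hlip t
            _ = _ := by ring
      _ ≤ _ := by
          rw [intervalIntegral.integral_const_mul]
          gcongr
          exact integral_abs_mul_expSum_pow_four_le hm0
  rw [← hu0]
  calc ‖u 0‖ ≤ (1 / 2 + 8 * Real.pi ^ 3) / m * A := by
        refine le_of_mul_le_mul_left ?_ hJpos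
        linarith
    _ = (1 + 16 * Real.pi ^ 3) / (2 * m) * A := by
        congr 1
        field_simp
        ring
    _ ≤ _ := by gcongr

/-- Reverse Bernstein inequality for Fourier series: for every `q ∈ [1,∞]`
there is `C > 0` such that for any `N ≥ 1` and any finitely supported family
`(α_k)_{|k| ≥ N}`,
`‖∑_{|k|≥N} α_k e^{ik·}‖_{L^q(-π,π)} ≤ (C/N) ‖∑_{|k|≥N} k α_k e^{ik·}‖_{L^q(-π,π)}`. -/
theorem reverse_bernstein_fourier (q : ℝ≥0∞) (hq : 1 ≤ q) :
    ∃ C : ℝ, 0 < C ∧ ∀ N : ℕ, 0 < N → ∀ s : Finset ℤ,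
      (∀ k ∈ s, (N : ℤ) ≤ |k|) → ∀ α : ℤ → ℂ,
      eLpNorm (fun x : ℝ => ∑ k ∈ s, α k * Complex.exp (Complex.I * (k : ℂ) * (x : ℂ)))
          q (volume.restrict (Set.Ioo (-Real.pi) Real.pi)) ≤
        ENNReal.ofReal (C / N) *
        eLpNorm (fun x : ℝ => ∑ k ∈ s, (k : ℂ) * α k * Complex.exp (Complex.I * (k : ℂ) * (x : ℂ)))
          q (volume.restrict (Set.Ioo (-Real.pi) Real.pi)) := by
  have hp := Real.pi_pos
  refine ⟨1 + 16 * Real.pi ^ 3, by positivity, fun N hN s hs α => ?_⟩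
  have : Fact (1 ≤ q) := ⟨hq⟩
  have : Fact (0 < 2 * Real.pi) := ⟨by positivity⟩
  have hfourier (k : ℤ) (x : ℝ) :
      fourier k (x : AddCircle (2 * Real.pi)) = Complex.exp (Complex.I * k * x) := by
    rw [fourier_coe_apply]
    congr 1
    push_cast
    field_simp
  let L := ContinuousMap.toLp (E := ℂ) q (volume : Measure (AddCircle (2 * Real.pi))) ℂ
  have hnorm (f : C(AddCircle (2 * Real.pi), ℂ)) : ‖L f‖ₑ = eLpNorm f q volume := by
    rw [Lp.enorm_def]
    exact eLpNorm_congr_ae (ContinuousMap.coeFn_toLp _ f)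
  have hcircle (a : ℤ → ℂ) :
      eLpNorm (fun x : ℝ => ∑ k ∈ s, a k * Complex.exp (Complex.I * k * x)) q
        (volume.restrict (Set.Ioo (-Real.pi) Real.pi)) =
      ‖∑ k ∈ s, a k • L (fourier k)‖ₑ := by
    simp_rw [← map_smul, ← map_sum]
    rw [hnorm, Measure.restrict_congr_set Ioo_ae_eq_Ioc]
    have hmp := AddCircle.measurePreserving_mk (2 * Real.pi) (-Real.pi)
    rw [show -Real.pi + 2 * Real.pi = Real.pi by ring] at hmp
    rw [← eLpNorm_comp_measurePreserving
      (ContinuousMap.continuous _).aestronglyMeasurable hmp]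
    congr 1
    ext x
    simp [hfourier]
  have hinv (a : ℤ → ℂ) (t : ℝ) :
      ‖∑ k ∈ s, (a k * Complex.exp (Complex.I * k * t)) • L (fourier k)‖ =
        ‖∑ k ∈ s, a k • L (fourier k)‖ := by
    rw [← toReal_enorm, ← toReal_enorm]
    congr 1
    simp_rw [← hfourier, ← map_smul, ← map_sum]
    rw [hnorm, hnorm, ← eLpNorm_comp_measurePreserving
      (ContinuousMap.continuous (∑ k ∈ s, a k • fourier k)).aestronglyMeasurable
      (measurePreserving_add_right volume (t : AddCircle (2 * Real.pi)))]
    congr 1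
    ext x
    simp [fourier_apply, mul_assoc, mul_comm, AddCircle.toCircle_add]
  rw [hcircle α, hcircle fun k => k * α k, ← ofReal_norm, ← ofReal_norm,
    ← ENNReal.ofReal_mul (by positivity)]
  exact ENNReal.ofReal_le_ofReal (norm_sum_le_of_translation_invariant _ s hinv hN hs α)
end
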